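/- arXiv:1410.1164 — 9 statements merged into one kernel-verified Lean document; each statement's English description precedes it below -/
import Mathlib

section
/- The cone P_ℚ is a closed subset of ℚ^r (with its metric topology), and Δ_P is an open subset of P_ℚ in the subspace topology; that is, there exists an open subset U of ℚ^r with Δ_P = U ∩ P_ℚ. -/
open scoped Pointwise

/-- The subgroup `P^gp` of `ℚ^r` generated by the submonoid `P`. -/
def Pgp {r : ℕ} (P : AddSubmonoid (Fin r → ℚ)) : AddSubgroup (Fin r → ℚ) :=
  AddSubgroup.closure (P : Set (Fin r → ℚ))

/-- The rational cone `P_ℚ` generated by `P`. -/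
def PQ {r : ℕ} (P : AddSubmonoid (Fin r → ℚ)) : Set (Fin r → ℚ) :=
  {v | ∃ n : ℕ, 0 < n ∧ n • v ∈ P}

/-- `P⁺ = P \ {0}`. -/
def Pplus {r : ℕ} (P : AddSubmonoid (Fin r → ℚ)) : Set (Fin r → ℚ) :=
  (P : Set (Fin r → ℚ)) \ {0}

/-- `Δ_P = P_ℚ \ (P⁺ + P_ℚ)`. -/
def Delta {r : ℕ} (P : AddSubmonoid (Fin r → ℚ)) : Set (Fin r → ℚ) :=
  PQ P \ (Pplus P + PQ P)

/-- Fourier–Motzkin elimination: adding a ray `g` to a cone cut out by finitely many linear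
inequalities gives a cone cut out by finitely many linear inequalities. -/
lemma exists_finite_dual_add_ray {K V : Type*} [Field K] [LinearOrder K] [IsStrictOrderedRing K]
    [AddCommGroup V] [Module K V] {F : Set (V →ₗ[K] K)} (hF : F.Finite) (g : V) :
    ∃ F' : Set (V →ₗ[K] K), F'.Finite ∧
      ∀ v, (∀ f ∈ F', 0 ≤ f v) ↔ ∃ t : K, 0 ≤ t ∧ ∀ f ∈ F, 0 ≤ f (v - t • g) := by
  refine ⟨{f ∈ F | 0 ≤ f g} ∪
    Set.image2 (fun f h => f g • h - h g • f) {f ∈ F | 0 < f g} {h ∈ F | h g < 0},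
    (hF.sep _).union ((hF.sep _).image2 _ (hF.sep _)), fun v => ⟨fun hv => ?_, ?_⟩⟩
  · have hpos : ∀ f ∈ F, 0 ≤ f g → 0 ≤ f v := fun f hf hfg => hv f (Or.inl ⟨hf, hfg⟩)
    have hpair : ∀ f ∈ F, 0 < f g → ∀ h ∈ F, h g < 0 → 0 ≤ f g * h v - h g * f v :=
      fun f hf hfg h hh hhg => by
        simpa using hv _ (Or.inr ⟨f, ⟨hf, hfg⟩, h, ⟨hh, hhg⟩, rfl⟩)
    obtain ⟨t, ht, hmax⟩ := Set.exists_max_image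
      (insert 0 ((fun h : V →ₗ[K] K => h v / h g) '' {h ∈ F | h g < 0})) id
      (((hF.sep _).image _).insert 0) (Set.insert_nonempty _ _)
    refine ⟨t, hmax 0 (Set.mem_insert _ _), fun f hf => ?_⟩
    rw [map_sub, map_smul, smul_eq_mul, sub_nonneg]
    rcases lt_trichotomy (f g) 0 with hfg | hfg | hfg
    · have := hmax (f v / f g) (Set.mem_insert_of_mem _ ⟨f, ⟨hf, hfg⟩, rfl⟩)
      exact (div_le_iff_of_neg hfg).1 this
    · simpa [hfg] using hpos f hf hfg.ge
    · rcases ht with rfl | ⟨h, ⟨hh, hhg⟩, rfl⟩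
      · simpa using hpos f hf hfg.le
      · have := hpair f hf hfg h hh hhg
        change h v / h g * f g ≤ f v
        rw [div_mul_eq_mul_div, div_le_iff_of_neg hhg]
        linarith
  · rintro ⟨t, ht, h⟩ f (⟨hf, hfg⟩ | ⟨f, ⟨hf, hfg⟩, k, ⟨hk, hkg⟩, rfl⟩)
    · have h₁ := h f hf
      rw [map_sub, map_smul, smul_eq_mul, sub_nonneg] at h₁
      exact (mul_nonneg ht hfg).trans h₁
    · have h₁ := mul_nonneg hfg.le (h k hk)
      have h₂ := mul_nonneg (neg_nonneg.2 hkg.le) (h f hf)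
      simp only [map_sub, map_smul, smul_eq_mul] at h₁ h₂
      simp only [LinearMap.sub_apply, LinearMap.smul_apply, smul_eq_mul]
      linarith

/-- A finitely generated cone in `K^n` is cut out by finitely many linear inequalities. -/
lemma exists_finite_dual_eq_hull {K ι : Type*} [Field K] [LinearOrder K] [IsStrictOrderedRing K]
    [Finite ι] {S : Set (ι → K)} (hS : S.Finite) :
    ∃ F : Set ((ι → K) →ₗ[K] K), F.Finite ∧
      ∀ v, (∀ f ∈ F, 0 ≤ f v) ↔ v ∈ PointedCone.hull K S := by
  induction S, hS using Set.Finite.induction_on with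
  | empty =>
    refine ⟨Set.range (fun i => LinearMap.proj i) ∪ Set.range (fun i => -LinearMap.proj i),
      (Set.finite_range _).union (Set.finite_range _), fun v => ⟨fun h => ?_, fun h => ?_⟩⟩
    · have : v = 0 := funext fun i => le_antisymm
        (by simpa using h _ (Or.inr ⟨i, rfl⟩)) (h _ (Or.inl ⟨i, rfl⟩))
      simp [this]
    · have : v = 0 := by simpa [PointedCone.hull] using h
      simp [this]
  | @insert g S _ _ ih =>
    obtain ⟨F, hF, hFS⟩ := ih
    obtain ⟨F', hF', h⟩ := exists_finite_dual_add_ray hF g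
    refine ⟨F', hF', fun v => (h v).trans ?_⟩
    simp only [hFS]
    refine Iff.trans ?_ Submodule.mem_span_insert.symm
    constructor
    · rintro ⟨t, ht, hv⟩
      exact ⟨⟨t, ht⟩, _, hv, by simp [Nonneg.mk_smul]⟩
    · rintro ⟨t, z, hz, rfl⟩
      refine ⟨t, t.2, ?_⟩
      have : t • g + z - (t : K) • g = z := by
        rw [Nonneg.coe_smul, add_sub_cancel_left]
      rwa [this]

lemma isClosed_hull_of_finite {K ι : Type*} [Field K] [LinearOrder K] [IsStrictOrderedRing K]
    [TopologicalSpace K] [IsTopologicalRing K] [OrderClosedTopology K]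
    [Finite ι] {S : Set (ι → K)} (hS : S.Finite) :
    IsClosed (PointedCone.hull K S : Set (ι → K)) := by
  obtain ⟨F, -, hFS⟩ := exists_finite_dual_eq_hull hS
  have : (PointedCone.hull K S : Set (ι → K)) = ⋂ f ∈ F, {v | 0 ≤ f v} := by
    ext v
    simp [← hFS]
  rw [this]
  exact isClosed_biInter fun f _ => isClosed_le continuous_const (LinearMap.continuous_on_pi f)

lemma PQ_closure {r : ℕ} (S : Set (Fin r → ℚ)) :
    PQ (AddSubmonoid.closure S) = (PointedCone.hull ℚ S : Set (Fin r → ℚ)) := by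
  ext v
  constructor
  · rintro ⟨n, hn, hv⟩
    have hle : AddSubmonoid.closure S ≤ (PointedCone.hull ℚ S).toAddSubmonoid :=
      (AddSubmonoid.closure_le).2 Submodule.subset_span
    have hn' : (0 : ℚ) ≤ (n : ℚ)⁻¹ := by positivity
    have := (PointedCone.hull ℚ S).smul_mem hn' (hle hv)
    rw [← Nat.cast_smul_eq_nsmul ℚ n v, smul_smul,
      inv_mul_cancel₀ (by positivity), one_smul] at this
    exact this
  · intro hv
    induction hv using Submodule.span_induction with
    | mem x hx => exact ⟨1, one_pos, by rw [one_smul]; exact AddSubmonoid.subset_closure hx⟩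
    | zero => exact ⟨1, one_pos, by simp⟩
    | add x y _ _ hx hy =>
      obtain ⟨n, hn, hx⟩ := hx
      obtain ⟨m, hm, hy⟩ := hy
      refine ⟨m * n, by positivity, ?_⟩
      rw [smul_add, mul_smul, mul_comm, mul_smul]
      exact add_mem (nsmul_mem hx m) (nsmul_mem hy n)
    | smul q x _ hx =>
      obtain ⟨n, hn, hx⟩ := hx
      obtain ⟨q, hq⟩ := q
      refine ⟨n * q.den, Nat.mul_pos hn q.pos, ?_⟩
      have : (n * q.den) • ((⟨q, hq⟩ : {c : ℚ // 0 ≤ c}) • x) = q.num.toNat • (n • x) := by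
        have hnum : ((q.num.toNat : ℕ) : ℚ) = q.den * q := by
          rw [Rat.den_mul_eq_num]
          exact_mod_cast Int.toNat_of_nonneg (Rat.num_nonneg.2 hq)
        ext i
        simp only [Nonneg.mk_smul, Pi.smul_apply]
        simp only [nsmul_eq_mul, smul_eq_mul, hnum]
        push_cast
        ring
      rw [this]
      exact nsmul_mem hx _

lemma isClosed_PQ {r : ℕ} {P : AddSubmonoid (Fin r → ℚ)} (hfg : P.FG) : IsClosed (PQ P) := by
  obtain ⟨S, rfl⟩ := hfg
  rw [PQ_closure]
  exact isClosed_hull_of_finite S.finite_toSet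

lemma add_mem_PQ {r : ℕ} {P : AddSubmonoid (Fin r → ℚ)} {x y : Fin r → ℚ} (hx : x ∈ P)
    (hy : y ∈ PQ P) : x + y ∈ PQ P := by
  obtain ⟨n, hn, hy⟩ := hy
  exact ⟨n, hn, by rw [smul_add]; exact add_mem (nsmul_mem hx n) hy⟩

/-- A nonzero element of the monoid generated by `S` is a nonzero element of `S` plus an
element of the monoid. -/
lemma AddSubmonoid.exists_add_of_mem_closure {M : Type*} [AddCommMonoid M] {S : Set M} {x : M}
    (hx : x ∈ AddSubmonoid.closure S) :
    x = 0 ∨ ∃ g ∈ S, g ≠ 0 ∧ ∃ y ∈ AddSubmonoid.closure S, x = g + y := by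
  induction hx using AddSubmonoid.closure_induction with
  | mem x hx =>
    by_cases h : x = 0
    · exact Or.inl h
    · exact Or.inr ⟨x, hx, h, 0, zero_mem _, (add_zero x).symm⟩
  | zero => exact Or.inl rfl
  | add x y _ hy ihx ihy =>
    rcases ihx with rfl | ⟨g, hg, hg0, z, hz, rfl⟩
    · simpa using ihy
    · exact Or.inr ⟨g, hg, hg0, z + y, add_mem hz hy, add_assoc _ _ _⟩

lemma isClosed_Pplus_add_PQ {r : ℕ} {P : AddSubmonoid (Fin r → ℚ)} (hfg : P.FG) :
    IsClosed (Pplus P + PQ P) := by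
  have hclosed := isClosed_PQ hfg
  obtain ⟨S, rfl⟩ := hfg
  have : Pplus (AddSubmonoid.closure (S : Set (Fin r → ℚ))) + PQ (AddSubmonoid.closure S) =
      ⋃ g ∈ {g ∈ (S : Set (Fin r → ℚ)) | g ≠ 0}, (fun v => g + v) ''
        PQ (AddSubmonoid.closure (S : Set (Fin r → ℚ))) := by
    ext v
    simp only [Set.mem_iUnion, Set.mem_add]
    constructor
    · rintro ⟨p, ⟨hp, hp0⟩, w, hw, rfl⟩
      obtain h | ⟨g, hg, hg0, y, hy, rfl⟩ := AddSubmonoid.exists_add_of_mem_closure hp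
      · exact absurd h hp0
      · exact ⟨g, ⟨hg, hg0⟩, y + w, add_mem_PQ hy hw, (add_assoc _ _ _).symm⟩
    · rintro ⟨g, ⟨hg, hg0⟩, w, hw, rfl⟩
      exact ⟨g, ⟨AddSubmonoid.subset_closure hg, hg0⟩, w, hw, rfl⟩
  rw [this]
  exact (S.finite_toSet.sep _).isClosed_biUnion fun g _ =>
    (Homeomorph.addLeft g).isClosedMap _ hclosed


/-- `P_ℚ` is closed in `ℚ^r`, and `Δ_P` is open in `P_ℚ` in the subspace topology. -/
theorem cone_closed_and_delta_open {r : ℕ} (hr : 0 < r) (P : AddSubmonoid (Fin r → ℚ))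
    (hfg : P.FG)
    (hsharp : ∀ v : Fin r → ℚ, v ∈ P → -v ∈ P → v = 0)
    (hsat : ∀ v : Fin r → ℚ, v ∈ Pgp P → (∃ n : ℕ, 0 < n ∧ n • v ∈ P) → v ∈ P)
    (hspan : Submodule.span ℚ (P : Set (Fin r → ℚ)) = ⊤) :
    IsClosed (PQ P) ∧
      ∃ U : Set (Fin r → ℚ), IsOpen U ∧ Delta P = U ∩ PQ P := by
  exact ⟨isClosed_PQ hfg, (Pplus P + PQ P)ᶜ, (isClosed_Pplus_add_PQ hfg).isOpen_compl,
    Set.sdiff_eq_compl_inter⟩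
end

section
/- The set Δ_P is bounded in ℚ^r: there exists a constant C such that ‖γ‖ ≤ C for every γ ∈ Δ_P. -/
open scoped Pointwise

/-- If `n • γ` is a natural combination of a finite set of elements of `P` and `γ ∈ Δ_P`, then every
nonzero element of the set occurs with coefficient less than `n`. -/
theorem coeff_lt_of_mem_Delta {r : ℕ} {P : AddSubmonoid (Fin r → ℚ)} {S : Finset (Fin r → ℚ)}
    (hS : ∀ s ∈ S, s ∈ P) {γ : Fin r → ℚ} (hγ : γ ∈ Delta P) {n : ℕ} (hn : 0 < n)
    {a : (Fin r → ℚ) → ℕ} (ha : n • γ = ∑ s ∈ S, a s • s) {t : Fin r → ℚ} (ht : t ∈ S)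
    (ht0 : t ≠ 0) : a t < n := by
  by_contra! hle
  refine hγ.2 (Set.mem_add.2 ⟨t, ⟨hS t ht, ht0⟩, γ - t, ⟨n, hn, ?_⟩, by abel⟩)
  have key : n • (γ - t) = (a t - n) • t + ∑ s ∈ S.erase t, a s • s := by
    rw [nsmul_sub, ha, ← Finset.add_sum_erase S _ ht, sub_nsmul t hle]
    abel
  rw [key]
  exact P.add_mem (P.nsmul_mem (hS t ht) _)
    (P.sum_mem fun s hs => P.nsmul_mem (hS s (Finset.mem_of_mem_erase hs)) _)

/-- The set `Δ_P` is bounded in `ℚ^r`. -/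
theorem delta_bounded {r : ℕ} (hr : 0 < r) (P : AddSubmonoid (Fin r → ℚ))
    (hfg : P.FG)
    (hsharp : ∀ v : Fin r → ℚ, v ∈ P → -v ∈ P → v = 0)
    (hsat : ∀ v : Fin r → ℚ, v ∈ Pgp P → (∃ n : ℕ, 0 < n ∧ n • v ∈ P) → v ∈ P)
    (hspan : Submodule.span ℚ (P : Set (Fin r → ℚ)) = ⊤) :
    ∃ C : ℝ, ∀ γ ∈ Delta P, ‖γ‖ ≤ C := by
  obtain ⟨S, hS⟩ := hfg
  have hSP : ∀ s ∈ S, s ∈ P := fun s hs => hS ▸ AddSubmonoid.subset_closure hs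
  refine ⟨∑ s ∈ S, ‖s‖, fun γ hγ => ?_⟩
  obtain ⟨n, hn, hnγ⟩ := hγ.1
  rw [← hS, AddSubmonoid.mem_closure_finset] at hnγ
  obtain ⟨a, -, ha⟩ := hnγ
  have norm_nat (m : ℕ) (v : Fin r → ℚ) : ‖m • v‖ = m * ‖v‖ := by
    rw [← Nat.cast_smul_eq_nsmul ℚ, norm_smul, ← Rat.norm_cast_real]
    simp
  refine le_of_mul_le_mul_left ?_ (Nat.cast_pos.2 hn : (0 : ℝ) < n)
  rw [← norm_nat, ← ha, Finset.mul_sum]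
  refine (norm_sum_le _ _).trans (Finset.sum_le_sum fun s hs => ?_)
  rcases eq_or_ne s 0 with rfl | hs0
  · simp
  · rw [norm_nat]
    have := (coeff_lt_of_mem_Delta hSP hγ hn ha.symm hs hs0).le
    gcongr
end

section
/- If λ is an infinite quotient, then there exists a positive integer n₀ such that for every positive integer n divisible by n₀, the class λ_n is represented by an element of Δ_P⁰; that is, λ_n = [γ] in ℚ^r ⧸ P^gp for some γ ∈ Δ_P⁰. -/
open scoped Pointwise BigOperators

/-- `Δ_P⁰ = {γ ∈ Δ_P | (γ + P^gp) ∩ Δ_P = {γ}}`. -/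
def Delta0 {r : ℕ} (P : AddSubmonoid (Fin r → ℚ)) : Set (Fin r → ℚ) :=
  {γ | γ ∈ Delta P ∧ {δ | δ ∈ Delta P ∧ δ - γ ∈ Pgp P} = {γ}}

/-- A compatible family: `λ_1 = 0` and `(n/m) • λ_n = λ_m` whenever `m ∣ n`. -/
def IsCompatible {r : ℕ} (P : AddSubmonoid (Fin r → ℚ))
    (l : ℕ → (Fin r → ℚ) ⧸ Pgp P) : Prop :=
  l 1 = 0 ∧ ∀ m n : ℕ, 0 < m → 0 < n → m ∣ n → (n / m) • l n = l m

/-- A compatible family is an infinite quotient if it admits a characteristic integer `m₀`: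
for every positive `j` there are `γ_1, …, γ_j ∈ Δ_P`, each of class `λ_{j·m₀}`, whose sum
lies in `Δ_P`. -/
def IsInfiniteQuotient {r : ℕ} (P : AddSubmonoid (Fin r → ℚ))
    (l : ℕ → (Fin r → ℚ) ⧸ Pgp P) : Prop :=
  ∃ m₀ : ℕ, 0 < m₀ ∧ ∀ j : ℕ, 0 < j → ∃ γ : Fin j → (Fin r → ℚ),
    (∀ i, γ i ∈ Delta P ∧
      (QuotientAddGroup.mk (γ i) : (Fin r → ℚ) ⧸ Pgp P) = l (j * m₀)) ∧
    (∑ i, γ i) ∈ Delta P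

section FinitelyGenerated

variable {G : Type*} [AddCommGroup G] {P : AddSubmonoid G}

/-- **Dickson's lemma** for finitely generated submonoids of commutative groups. -/
theorem AddSubmonoid.FG.wellQuasiOrdered_sub_mem (hP : P.FG) :
    WellQuasiOrdered fun x y : P => (y - x : G) ∈ P := by
  classical
  obtain ⟨S, rfl⟩ := hP
  intro x
  have hx (k : ℕ) : ∃ c : S → ℕ, ∑ a, c a • (a : G) = x k := by
    obtain ⟨f, -, hf⟩ := AddSubmonoid.mem_closure_finset.mp (x k).2
    exact ⟨fun a => f a, by rw [← hf, ← Finset.sum_coe_sort S]⟩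
  choose c hc using hx
  obtain ⟨m, n, hmn, hle⟩ := wellQuasiOrdered_le c
  refine ⟨m, n, hmn, ?_⟩
  change (x n : G) - x m ∈ _
  rw [← hc m, ← hc n, ← Finset.sum_sub_distrib]
  refine AddSubmonoid.sum_mem _ fun a _ => ?_
  rw [sub_eq_add_neg, ← sub_nsmul _ (hle a)]
  exact AddSubmonoid.nsmul_mem _ (AddSubmonoid.subset_closure a.2) _

/-- A bounded interval for the order defined by a finitely generated sharp monoid is finite. -/
theorem AddSubmonoid.FG.finite_setOf_add_mem_sub_mem (hP : P.FG)
    (hsharp : ∀ v : G, v ∈ P → -v ∈ P → v = 0) (p : G) :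
    {x : G | p + x ∈ P ∧ p - x ∈ P}.Finite := by
  by_contra hinf
  let e := Set.Infinite.natEmbedding _ hinf
  obtain ⟨m, n, hmn, h₁, h₂⟩ := (hP.prod hP).wellQuasiOrdered_sub_mem
    fun k => ⟨(p + e k, p - e k), (e k).2⟩
  have h := hsharp ((e n : G) - e m) (by simpa using h₁) (by simpa using h₂)
  exact hmn.ne (e.injective (Subtype.ext (sub_eq_zero.mp h).symm))

/-- If infinitely many points of a ray `p + k • x` lie in a finitely generated monoid, then so does
some positive multiple of its direction `x`. -/
theorem AddSubmonoid.FG.exists_pos_nsmul_mem_of_infinite (hP : P.FG) {x p : G}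
    (hinf : {k : ℕ | k • x + p ∈ P}.Infinite) : ∃ n : ℕ, 0 < n ∧ n • x ∈ P := by
  have := hinf.to_subtype
  classical
  let e := Nat.orderEmbeddingOfSet {k : ℕ | k • x + p ∈ P}
  have he (k : ℕ) : e k • x + p ∈ P := (Nat.Subtype.ofNat {k : ℕ | k • x + p ∈ P} k).2
  obtain ⟨m, n, hmn, h⟩ := hP.wellQuasiOrdered_sub_mem fun k => ⟨e k • x + p, he k⟩
  have hlt : e m < e n := e.strictMono hmn
  refine ⟨e n - e m, Nat.sub_pos_of_lt hlt, ?_⟩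
  rw [sub_nsmul _ hlt.le, ← sub_eq_add_neg]
  simpa using h

end FinitelyGenerated

section RationalCone

variable {r : ℕ} {P : AddSubmonoid (Fin r → ℚ)}

theorem mem_PQ_of_mem {v : Fin r → ℚ} (hv : v ∈ P) : v ∈ PQ P :=
  ⟨1, one_pos, by simpa using hv⟩

theorem add_mem_PQ_s5 {v w : Fin r → ℚ} (hv : v ∈ PQ P) (hw : w ∈ PQ P) : v + w ∈ PQ P := by
  obtain ⟨m, hm, hv⟩ := hv
  obtain ⟨n, hn, hw⟩ := hw
  refine ⟨n * m, Nat.mul_pos hn hm, ?_⟩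
  rw [nsmul_add, mul_nsmul', mul_comm, mul_nsmul']
  exact P.add_mem (P.nsmul_mem hv n) (P.nsmul_mem hw m)

theorem sum_mem_PQ {ι : Type*} {s : Finset ι} {f : ι → Fin r → ℚ} (hf : ∀ i ∈ s, f i ∈ PQ P) :
    ∑ i ∈ s, f i ∈ PQ P :=
  Finset.sum_induction f (· ∈ PQ P) (fun _ _ => add_mem_PQ_s5) (mem_PQ_of_mem P.zero_mem) hf

theorem nsmul_mem_PQ {v : Fin r → ℚ} (hv : v ∈ PQ P) (n : ℕ) : n • v ∈ PQ P := by
  simpa using sum_mem_PQ (s := Finset.range n) (f := fun _ => v) fun _ _ => hv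

/-- The region `Δ_P` is bounded above, in the order defined by `P_ℚ`, by an element of `P`. -/
theorem exists_forall_mem_Delta_sub_mem_PQ (hfg : P.FG) :
    ∃ p ∈ P, ∀ v ∈ Delta P, p - v ∈ PQ P := by
  classical
  obtain ⟨S, hS⟩ := hfg
  have hSP : ∀ a ∈ S, a ∈ P := fun a ha => hS ▸ AddSubmonoid.subset_closure ha
  refine ⟨∑ a ∈ S, a, P.sum_mem hSP, ?_⟩
  rintro v ⟨⟨n, hn, hv⟩, hmin⟩
  rw [← hS] at hv
  obtain ⟨f, -, hf⟩ := AddSubmonoid.mem_closure_finset.mp hv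
  refine ⟨n, hn, ?_⟩
  rw [nsmul_sub, ← hf, Finset.smul_sum, ← Finset.sum_sub_distrib]
  refine P.sum_mem fun a ha => ?_
  by_cases h0 : a = 0
  · simp [h0]
  rcases le_total (f a) n with hle | hle
  · rw [sub_eq_add_neg, ← sub_nsmul _ hle]
    exact P.nsmul_mem (hSP a ha) _
  refine absurd (Set.mem_add.mpr ?_) hmin
  refine ⟨a, ⟨hSP a ha, h0⟩, v - a, ⟨n, hn, ?_⟩, add_sub_cancel a v⟩
  rw [nsmul_sub, ← hf, ← Finset.add_sum_erase _ _ ha, add_sub_right_comm, sub_eq_add_neg,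
    ← sub_nsmul _ hle]
  exact P.add_mem (P.nsmul_mem (hSP a ha) _)
    (P.sum_mem fun b hb => P.nsmul_mem (hSP b (Finset.mem_of_mem_erase hb)) _)

theorem subset_Pgp {v : Fin r → ℚ} (hv : v ∈ P) : v ∈ Pgp P :=
  AddSubgroup.subset_closure hv

end RationalCone

/-- If `λ` is an infinite quotient, then for all sufficiently divisible `n` the class `λ_n`
is represented by an element of `Δ_P⁰`. -/
theorem infiniteQuotient_rep_in_delta0 {r : ℕ} (hr : 0 < r) (P : AddSubmonoid (Fin r → ℚ))
    (hfg : P.FG)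
    (hsharp : ∀ v : Fin r → ℚ, v ∈ P → -v ∈ P → v = 0)
    (hsat : ∀ v : Fin r → ℚ, v ∈ Pgp P → (∃ n : ℕ, 0 < n ∧ n • v ∈ P) → v ∈ P)
    (hspan : Submodule.span ℚ (P : Set (Fin r → ℚ)) = ⊤)
    (l : ℕ → (Fin r → ℚ) ⧸ Pgp P)
    (hl : IsCompatible P l) (hinf : IsInfiniteQuotient P l) :
    ∃ n₀ : ℕ, 0 < n₀ ∧ ∀ n : ℕ, 0 < n → n₀ ∣ n →
      ∃ γ ∈ Delta0 P, l n = QuotientAddGroup.mk γ := by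
  classical
  replace hsat : ∀ v ∈ Pgp P, v ∈ PQ P → v ∈ P := hsat
  obtain ⟨p, hpP, hp⟩ := exists_forall_mem_Delta_sub_mem_PQ hfg
  obtain ⟨m₀, hm₀, hinf⟩ := hinf
  have hF := hfg.finite_setOf_add_mem_sub_mem hsharp p
  set F := {x | p + x ∈ P ∧ p - x ∈ P}
  have hsub {γ δ : Fin r → ℚ} (hγ : γ ∈ Delta P) (hδ : δ ∈ Delta P) (h : δ - γ ∈ Pgp P) :
      δ - γ ∈ F := by
    refine ⟨hsat _ (add_mem (subset_Pgp hpP) h) ?_, hsat _ (sub_mem (subset_Pgp hpP) h) ?_⟩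
    · convert add_mem_PQ_s5 (hp γ hγ) hδ.1 using 1; abel
    · convert add_mem_PQ_s5 (hp δ hδ) hγ.1 using 1; abel
  have hbad : (⋃ x ∈ {x ∈ F | x ∈ Pgp P ∧ x ∉ P}, {k : ℕ | k • x + p ∈ P}).Finite := by
    refine (hF.subset (Set.sep_subset _ _)).biUnion fun x hx => ?_
    by_contra hinf'
    exact hx.2.2 (hsat x hx.2.1 (hfg.exists_pos_nsmul_mem_of_infinite hinf'))
  obtain ⟨K, hK⟩ := hbad.exists_notMem
  refine ⟨(hF.toFinset.card * K + 1) * m₀, by positivity, ?_⟩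
  rintro n hn ⟨t, rfl⟩
  have ht : 0 < t := Nat.pos_of_mul_pos_left hn
  set j := (hF.toFinset.card * K + 1) * t with hj
  have hj0 : 0 < j := by positivity
  obtain ⟨γ, hγ, hsum⟩ := hinf j hj0
  have hcls (i i' : Fin j) : γ i - γ i' ∈ Pgp P := by
    rw [sub_eq_neg_add]
    exact QuotientAddGroup.eq.mp ((hγ i').2.trans (hγ i).2.symm)
  let i₀ : Fin j := ⟨0, hj0⟩
  obtain ⟨y, -, hy⟩ := Finset.exists_lt_card_fiber_of_mul_lt_card_of_maps_to
    (s := Finset.univ) (t := hF.toFinset) (f := fun i => γ i - γ i₀) (n := K)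
    (fun i _ => hF.mem_toFinset.mpr (hsub (hγ i₀).1 (hγ i).1 (hcls i i₀)))
    (by rw [Finset.card_univ, Fintype.card_fin]; nlinarith)
  obtain ⟨T, hT, hTK⟩ := Finset.exists_subset_card_eq hy.le
  obtain ⟨i₁, hi₁⟩ := Finset.card_pos.mp (K.zero_le.trans_lt hy)
  have hconst : ∑ i ∈ T, γ i = K • γ i₁ := by
    rw [← hTK]
    refine Finset.sum_eq_card_nsmul fun i hi => ?_
    have h₁ := (Finset.mem_filter.mp (hT hi)).2
    have h₂ := (Finset.mem_filter.mp hi₁).2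
    exact sub_left_injective (h₁.trans h₂.symm)
  have hsmall : p - K • γ i₁ ∈ PQ P := by
    convert add_mem_PQ_s5 (hp _ hsum) (sum_mem_PQ (s := Tᶜ) fun i _ => (hγ i).1.1) using 1
    rw [← hconst, ← Finset.sum_add_sum_compl T γ]
    abel
  refine ⟨γ i₁, ⟨(hγ i₁).1, ?_⟩, ?_⟩
  · refine Set.eq_singleton_iff_unique_mem.mpr ⟨⟨(hγ i₁).1, by simp⟩, ?_⟩
    rintro δ ⟨hδ, hδγ⟩
    have hmem : K • (δ - γ i₁) + p ∈ P := by
      refine hsat _ (add_mem (nsmul_mem hδγ K) (subset_Pgp hpP)) ?_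
      convert add_mem_PQ_s5 (nsmul_mem_PQ hδ.1 K) hsmall using 1
      rw [nsmul_sub]
      abel
    have hP : δ - γ i₁ ∈ P := by
      by_contra hnot
      exact hK (Set.mem_biUnion (x := δ - γ i₁) ⟨hsub (hγ i₁).1 hδ hδγ, hδγ, hnot⟩ hmem)
    by_contra hne
    exact hδ.2 (Set.mem_add.mpr
      ⟨δ - γ i₁, ⟨hP, sub_ne_zero.mpr hne⟩, γ i₁, (hγ i₁).1.1, sub_add_cancel _ _⟩)
  · rw [(hγ i₁).2, hj]
    congr 1
    ring
end

section
/- If λ and λ' are infinite quotients, then there exists a positive integer n₀ such that for every positive integer n divisible by n₀ one can write λ_n = [γ] and λ'_n = [γ'] in ℚ^r ⧸ P^gp with γ, γ' ∈ Δ_P and γ + γ' ∈ Δ_P⁰. -/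
open scoped Pointwise BigOperators

theorem PQ_of_mem {r : ℕ} {P : AddSubmonoid (Fin r → ℚ)} {v : Fin r → ℚ} (hv : v ∈ P) :
    v ∈ PQ P :=
  ⟨1, one_pos, by simpa using hv⟩

theorem PQ_add {r : ℕ} {P : AddSubmonoid (Fin r → ℚ)} {v w : Fin r → ℚ}
    (hv : v ∈ PQ P) (hw : w ∈ PQ P) : v + w ∈ PQ P := by
  obtain ⟨m, hm, hv⟩ := hv
  obtain ⟨n, hn, hw⟩ := hw
  refine ⟨m * n, Nat.mul_pos hm hn, ?_⟩
  have key : (m * n) • (v + w) = n • (m • v) + m • (n • w) := by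
    rw [smul_add, mul_comm m n, mul_smul, mul_comm n m, mul_smul]
  rw [key]
  exact P.add_mem (P.nsmul_mem hv n) (P.nsmul_mem hw m)

theorem PQ_nsmul {r : ℕ} {P : AddSubmonoid (Fin r → ℚ)} {v : Fin r → ℚ}
    (hv : v ∈ PQ P) (k : ℕ) : k • v ∈ PQ P := by
  obtain ⟨m, hm, hv⟩ := hv
  exact ⟨m, hm, by rw [smul_comm]; exact P.nsmul_mem hv k⟩

theorem PQ_of_nsmul {r : ℕ} {P : AddSubmonoid (Fin r → ℚ)} {v : Fin r → ℚ} {k : ℕ}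
    (hk : 0 < k) (hv : k • v ∈ PQ P) : v ∈ PQ P := by
  obtain ⟨m, hm, hv⟩ := hv
  exact ⟨m * k, Nat.mul_pos hm hk, by rwa [mul_smul]⟩

theorem PQ_sum {r : ℕ} {P : AddSubmonoid (Fin r → ℚ)} {ι : Type*} (s : Finset ι)
    (f : ι → Fin r → ℚ) (hf : ∀ i ∈ s, f i ∈ PQ P) : ∑ i ∈ s, f i ∈ PQ P :=
  Finset.sum_induction f (· ∈ PQ P) (fun _ _ => PQ_add) (PQ_of_mem P.zero_mem) hf

/-- Dickson's lemma for finitely generated submonoids of an abelian group. -/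
theorem AddSubmonoid.FG.exists_lt_sub_mem {V : Type*} [AddCommGroup V] {P : AddSubmonoid V}
    (hP : P.FG) (f : ℕ → V) (hf : ∀ n, f n ∈ P) : ∃ m n, m < n ∧ f n - f m ∈ P := by
  obtain ⟨S, rfl⟩ := hP
  have h := fun n => (AddSubmonoid.mem_closure_finset.1 (hf n))
  choose a _ ha using h
  obtain ⟨m, n, hmn, hle⟩ := wellQuasiOrdered_le (fun n (s : S) => a n s)
  refine ⟨m, n, hmn, ?_⟩
  rw [← ha m, ← ha n, ← Finset.sum_sub_distrib]
  refine AddSubmonoid.sum_mem _ fun s hs => ?_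
  rw [sub_eq_add_neg, ← sub_nsmul s (show a m s ≤ a n s from hle ⟨s, hs⟩)]
  exact AddSubmonoid.nsmul_mem _ (AddSubmonoid.subset_closure hs) _

theorem AddSubmonoid.FG.finite_order_interval {V : Type*} [AddCommGroup V] {P : AddSubmonoid V}
    (hP : P.FG) (hsharp : ∀ v, v ∈ P → -v ∈ P → v = 0) (e : V) :
    {p | e + p ∈ P ∧ e - p ∈ P}.Finite := by
  by_contra hinf
  have : Infinite {p | e + p ∈ P ∧ e - p ∈ P} := Set.infinite_coe_iff.2 hinf
  let f := Infinite.natEmbedding {p | e + p ∈ P ∧ e - p ∈ P}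
  obtain ⟨m, n, hmn, h1, h2⟩ := (hP.prod hP).exists_lt_sub_mem
    (fun n => (e + (f n : V), e - (f n : V))) (fun n => (f n).2)
  have h := hsharp ((f n : V) - f m) (by simpa using h1) (by simpa using h2)
  exact hmn.ne' (f.injective (Subtype.ext (sub_eq_zero.1 h)))

theorem exists_sub_mem_PQ_of_mem_Delta {r : ℕ} {P : AddSubmonoid (Fin r → ℚ)} (hP : P.FG) :
    ∃ e ∈ P, ∀ δ ∈ Delta P, e - δ ∈ PQ P := by
  classical
  obtain ⟨S, rfl⟩ := hP
  have hS : ∀ s ∈ S, s ∈ AddSubmonoid.closure (S : Set (Fin r → ℚ)) :=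
    fun s hs => AddSubmonoid.subset_closure hs
  refine ⟨∑ s ∈ S, s, AddSubmonoid.sum_mem _ hS, ?_⟩
  rintro δ ⟨⟨n, hn, hδ⟩, hnot⟩
  obtain ⟨a, -, ha⟩ := AddSubmonoid.mem_closure_finset.1 hδ
  refine ⟨n, hn, ?_⟩
  rw [smul_sub, ← ha, Finset.smul_sum, ← Finset.sum_sub_distrib]
  refine AddSubmonoid.sum_mem _ fun s hs => ?_
  rcases eq_or_ne s 0 with rfl | hs0
  · simp
  have hlt : a s ≤ n := by
    by_contra! hlt
    refine hnot ⟨s, ⟨hS s hs, hs0⟩, δ - s, ⟨n, hn, ?_⟩, by simp⟩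
    rw [smul_sub, ← ha, ← Finset.add_sum_erase S _ hs, add_sub_right_comm, sub_eq_add_neg, ← sub_nsmul _ hlt.le]
    exact add_mem (AddSubmonoid.nsmul_mem _ (hS s hs) _)
      (AddSubmonoid.sum_mem _ fun t ht =>
        AddSubmonoid.nsmul_mem _ (hS t (Finset.mem_of_mem_erase ht)) _)
  rw [sub_eq_add_neg, ← sub_nsmul _ hlt]
  exact AddSubmonoid.nsmul_mem _ (hS s hs) _

/-- If `p` lies in the group of a saturated finitely generated `P` and `n • p + e ∈ P` for all
`n`, then `p ∈ P`; and this is uniform over finite sets of such `p`. -/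
theorem exists_nat_forall_nsmul_add_mem {r : ℕ} {P : AddSubmonoid (Fin r → ℚ)} (hP : P.FG)
    (hsat : ∀ v : Fin r → ℚ, v ∈ Pgp P → v ∈ PQ P → v ∈ P) {e : Fin r → ℚ} (he : e ∈ P)
    {F : Set (Fin r → ℚ)} (hF : F.Finite) (hFP : F ⊆ Pgp P) :
    ∃ M : ℕ, 0 < M ∧ ∀ p ∈ F, M • p + e ∈ P → p ∈ P := by
  have key : ∀ p ∈ F, ∃ n : ℕ, n • p + e ∈ P → p ∈ P := by
    intro p hp
    by_contra! h
    obtain ⟨m, n, hmn, hd⟩ := hP.exists_lt_sub_mem _ (fun n => (h n).1)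
    refine (h 0).2 (hsat p (hFP hp) ⟨n - m, Nat.sub_pos_of_lt hmn, ?_⟩)
    rwa [add_sub_add_right_eq_sub, sub_eq_add_neg, ← sub_nsmul _ hmn.le] at hd
  choose! N hN using key
  refine ⟨hF.toFinset.sup N + 1, Nat.succ_pos _, fun p hp hM => hN p hp ?_⟩
  set M := hF.toFinset.sup N + 1
  have hle : N p ≤ M := (Finset.le_sup (f := N) (hF.mem_toFinset.2 hp)).trans (Nat.le_succ _)
  have hePgp : e ∈ Pgp P := AddSubgroup.subset_closure he
  refine hsat _ (add_mem (AddSubgroup.nsmul_mem _ (hFP hp) _) hePgp) ⟨M, Nat.succ_pos _, ?_⟩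
  have : M • (N p • p + e) = N p • (M • p + e) + (M - N p) • e := by
    rw [sub_nsmul _ hle, smul_add, smul_add, smul_comm]
    abel
  rw [this]
  exact add_mem (AddSubmonoid.nsmul_mem _ hM _) (AddSubmonoid.nsmul_mem _ he _)

/-- If a class `c` is represented by each of `j` elements of `Δ_P` whose sum lies in `Δ_P`, with `j`
large, then it has a small representative in `Δ_P`, smallness being measured against an upper
bound `e` of `Δ_P`. -/
theorem exists_small_rep {r : ℕ} {P : AddSubmonoid (Fin r → ℚ)}
    {e : Fin r → ℚ} (heΔ : ∀ δ ∈ Delta P, e - δ ∈ PQ P)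
    {F : Finset (Fin r → ℚ)}
    (hF : ∀ δ ∈ Delta P, ∀ δ' ∈ Delta P, δ - δ' ∈ Pgp P → δ - δ' ∈ F)
    {c : (Fin r → ℚ) ⧸ Pgp P} {j M : ℕ} (hj : F.card * M < j)
    (hc : ∃ γ : Fin j → (Fin r → ℚ), (∀ i, γ i ∈ Delta P ∧
      (QuotientAddGroup.mk (γ i) : (Fin r → ℚ) ⧸ Pgp P) = c) ∧ (∑ i, γ i) ∈ Delta P) :
    ∃ γ ∈ Delta P, c = QuotientAddGroup.mk γ ∧ e - M • γ ∈ PQ P := by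
  classical
  obtain ⟨γ, hγ, hsum⟩ := hc
  let i₀ : Fin j := ⟨0, (Nat.zero_le _).trans_lt hj⟩
  obtain ⟨y, -, hy⟩ := Finset.exists_lt_card_fiber_of_mul_lt_card_of_maps_to
    (s := Finset.univ) (t := F) (f := fun i => γ i - γ i₀) (n := M)
    (fun i _ => hF _ (hγ i).1 _ (hγ i₀).1 (by
      rw [sub_eq_neg_add]
      exact QuotientAddGroup.eq.1 ((hγ i₀).2.trans (hγ i).2.symm)))
    (by simpa using hj)
  set A := Finset.univ.filter fun i => γ i - γ i₀ = y
  obtain ⟨i, hi⟩ := Finset.card_pos.1 ((Nat.zero_le _).trans_lt hy)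
  refine ⟨γ i, (hγ i).1, (hγ i).2.symm, ?_⟩
  have hconst : ∑ k ∈ A, γ k = A.card • γ i := by
    refine Finset.sum_eq_card_nsmul fun k hk => ?_
    have h1 := (Finset.mem_filter.1 hk).2
    have h2 := (Finset.mem_filter.1 hi).2
    exact sub_left_injective (h1.trans h2.symm)
  have hsplit : e - M • γ i = (e - ∑ k, γ k) + ((A.card - M) • γ i + ∑ k ∈ Aᶜ, γ k) := by
    rw [← Finset.sum_add_sum_compl A, hconst, sub_nsmul _ hy.le]
    abel
  rw [hsplit]
  exact PQ_add (heΔ _ hsum) (PQ_add (PQ_nsmul (hγ i).1.1 _)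
    (PQ_sum _ _ fun k _ => (hγ k).1.1))

theorem mem_order_interval_of_mem_Pgp {r : ℕ} {P : AddSubmonoid (Fin r → ℚ)}
    (hsat : ∀ v : Fin r → ℚ, v ∈ Pgp P → v ∈ PQ P → v ∈ P) {e p : Fin r → ℚ} (he : e ∈ P)
    (hp : p ∈ Pgp P) (h₁ : e + p ∈ PQ P) (h₂ : e - p ∈ PQ P) :
    p ∈ {p | e + p ∈ P ∧ e - p ∈ P} :=
  have he' : e ∈ Pgp P := AddSubgroup.subset_closure he
  ⟨hsat _ (add_mem he' hp) h₁, hsat _ (sub_mem he' hp) h₂⟩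

theorem sub_mem_order_interval {r : ℕ} {P : AddSubmonoid (Fin r → ℚ)}
    (hsat : ∀ v : Fin r → ℚ, v ∈ Pgp P → v ∈ PQ P → v ∈ P) {e δ δ' : Fin r → ℚ} (he : e ∈ P)
    (heΔ : ∀ δ ∈ Delta P, e - δ ∈ PQ P) (hδ : δ ∈ Delta P) (hδ' : δ' ∈ Delta P)
    (h : δ - δ' ∈ Pgp P) : δ - δ' ∈ {p | e + p ∈ P ∧ e - p ∈ P} := by
  refine mem_order_interval_of_mem_Pgp hsat he h ?_ ?_
  · convert PQ_add (heΔ δ' hδ') hδ.1 using 1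
    abel
  · convert PQ_add (heΔ δ hδ) hδ'.1 using 1
    abel

/-- Sufficiently small elements of the cone lie in `Δ_P⁰`. -/
theorem exists_nat_forall_small_mem_Delta0 {r : ℕ} {P : AddSubmonoid (Fin r → ℚ)} (hP : P.FG)
    (hsharp : ∀ v : Fin r → ℚ, v ∈ P → -v ∈ P → v = 0)
    (hsat : ∀ v : Fin r → ℚ, v ∈ Pgp P → v ∈ PQ P → v ∈ P) {e : Fin r → ℚ} (he : e ∈ P)
    (heΔ : ∀ δ ∈ Delta P, e - δ ∈ PQ P) :
    ∃ M : ℕ, 0 < M ∧ ∀ w ∈ PQ P, e - M • w ∈ PQ P → w ∈ Delta0 P := by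
  have hPgp : ∀ {v}, v ∈ P → v ∈ Pgp P := fun hv => AddSubgroup.subset_closure hv
  have hFgp : {p | e + p ∈ P ∧ e - p ∈ P} ⊆ (Pgp P : Set (Fin r → ℚ)) := fun p hp => by
    simpa using sub_mem (hPgp hp.1) (hPgp he)
  obtain ⟨M, hM, hMF⟩ := exists_nat_forall_nsmul_add_mem hP hsat he
    (hP.finite_order_interval hsharp e) hFgp
  have hsmallΔ : ∀ w ∈ PQ P, e - M • w ∈ PQ P → w ∈ Delta P := by
    rintro w hw hwM
    refine ⟨hw, ?_⟩
    rintro ⟨p, ⟨hp, hp0⟩, q, hq, rfl⟩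
    have hMp : M • -p + e ∈ PQ P := by
      convert PQ_add hwM (PQ_nsmul hq M) using 1
      simp only [smul_add, smul_neg]
      abel
    have hep : e - p ∈ PQ P := by
      have hpM : e - p = (M • -p + e) + (M - 1) • p := by
        rw [sub_nsmul _ hM, smul_neg, one_nsmul]
        abel
      rw [hpM]
      exact PQ_add hMp (PQ_nsmul (PQ_of_mem hp) _)
    have hnp := mem_order_interval_of_mem_Pgp hsat he (neg_mem (hPgp hp))
      (by rwa [← sub_eq_add_neg]) (by rw [sub_neg_eq_add]; exact PQ_of_mem (add_mem he hp))
    refine hp0 (hsharp p hp (hMF _ hnp (hsat _ ?_ hMp)))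
    exact add_mem (AddSubgroup.nsmul_mem _ (neg_mem (hPgp hp)) _) (hPgp he)
  refine ⟨M, hM, ?_⟩
  intro w hw hwM
  have hwΔ := hsmallΔ w hw hwM
  refine ⟨hwΔ, Set.eq_singleton_iff_unique_mem.2 ⟨⟨hwΔ, by simp [zero_mem]⟩, ?_⟩⟩
  rintro δ ⟨hδ, hδw⟩
  have hmem := sub_mem_order_interval hsat he heΔ hδ hwΔ hδw
  have hdiff : δ - w ∈ P := by
    refine hMF _ hmem (hsat _ (add_mem (AddSubgroup.nsmul_mem _ hδw _) (hPgp he)) ?_)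
    convert PQ_add hwM (PQ_nsmul hδ.1 M) using 1
    rw [smul_sub]
    abel
  by_contra hne
  exact hδ.2 ⟨δ - w, ⟨hdiff, sub_ne_zero.2 hne⟩, w, hw, by simp⟩

/-- If `λ` and `λ'` are infinite quotients, then for all sufficiently divisible `n` one can
write `λ_n = [γ]` and `λ'_n = [γ']` with `γ, γ' ∈ Δ_P` and `γ + γ' ∈ Δ_P⁰`. -/
theorem infiniteQuotient_sum_rep_in_delta0 {r : ℕ} (hr : 0 < r)
    (P : AddSubmonoid (Fin r → ℚ))
    (hfg : P.FG)
    (hsharp : ∀ v : Fin r → ℚ, v ∈ P → -v ∈ P → v = 0)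
    (hsat : ∀ v : Fin r → ℚ, v ∈ Pgp P → (∃ n : ℕ, 0 < n ∧ n • v ∈ P) → v ∈ P)
    (hspan : Submodule.span ℚ (P : Set (Fin r → ℚ)) = ⊤)
    (l l' : ℕ → (Fin r → ℚ) ⧸ Pgp P)
    (hl : IsCompatible P l) (hl' : IsCompatible P l')
    (hinf : IsInfiniteQuotient P l) (hinf' : IsInfiniteQuotient P l') :
    ∃ n₀ : ℕ, 0 < n₀ ∧ ∀ n : ℕ, 0 < n → n₀ ∣ n →
      ∃ γ γ' : Fin r → ℚ, γ ∈ Delta P ∧ γ' ∈ Delta P ∧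
        l n = QuotientAddGroup.mk γ ∧ l' n = QuotientAddGroup.mk γ' ∧
        γ + γ' ∈ Delta0 P := by
  obtain ⟨e, he, heΔ⟩ := exists_sub_mem_PQ_of_mem_Delta hfg
  obtain ⟨M, hM, hsmall⟩ := exists_nat_forall_small_mem_Delta0 hfg hsharp hsat he heΔ
  obtain ⟨F, hF⟩ := (hfg.finite_order_interval hsharp e).exists_finset
  have hFΔ : ∀ δ ∈ Delta P, ∀ δ' ∈ Delta P, δ - δ' ∈ Pgp P → δ - δ' ∈ F :=
    fun δ hδ δ' hδ' h => (hF _).2 (sub_mem_order_interval hsat he heΔ hδ hδ' h)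
  obtain ⟨m, hm, hlm⟩ := hinf
  obtain ⟨m', hm', hlm'⟩ := hinf'
  obtain ⟨J, hJ⟩ := exists_gt (F.card * (2 * M))
  have hJ0 : 0 < J := (Nat.zero_le _).trans_lt hJ
  refine ⟨m * m' * J, by positivity, ?_⟩
  rintro _ hn ⟨t, rfl⟩
  have ht : 0 < t := Nat.pos_of_mul_pos_left hn
  have hlarge : ∀ k, 0 < k → F.card * (2 * M) < k * t * J := fun k hk =>
    hJ.trans_le (Nat.le_mul_of_pos_left _ (Nat.mul_pos hk ht))
  obtain ⟨γ, hγ, hlγ, hγM⟩ := exists_small_rep heΔ hFΔ (hlarge m' hm')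
    (hlm (m' * t * J) (by positivity))
  obtain ⟨γ', hγ', hlγ', hγM'⟩ := exists_small_rep heΔ hFΔ (hlarge m hm)
    (hlm' (m * t * J) (by positivity))
  refine ⟨γ, γ', hγ, hγ', ?_, ?_, hsmall _ (PQ_add hγ.1 hγ'.1) ?_⟩
  · rw [← hlγ]
    congr 1
    ring
  · rw [← hlγ']
    congr 1
    ring
  · refine PQ_of_nsmul two_pos ?_
    convert PQ_add hγM hγM' using 1
    simp only [smul_sub, smul_add, mul_smul, two_nsmul]
    abel
end

section
/- A compatible family λ is an infinite quotient if and only if there exists p ∈ P such that λ_n is the class of (1/n) • p in ℚ^r ⧸ P^gp for every positive integer n; moreover such an element p is unique. In other words, the image of P in the group of compatible families is precisely the set of infinite quotients, and the map from P to the set of infinite quotients is a bijection. -/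
open scoped Pointwise BigOperators

namespace InfiniteQuotient

variable {r : ℕ} {P : AddSubmonoid (Fin r → ℚ)}

/-- The rational cone `P_ℚ`, as an additive submonoid. -/
def cone (P : AddSubmonoid (Fin r → ℚ)) : AddSubmonoid (Fin r → ℚ) where
  carrier := PQ P
  zero_mem' := ⟨1, one_pos, by simp⟩
  add_mem' := by
    rintro a b ⟨n, hn, ha⟩ ⟨m, hm, hb⟩
    refine ⟨n * m, Nat.mul_pos hn hm, ?_⟩
    rw [nsmul_add, mul_comm n m, mul_nsmul' a, mul_comm m n, mul_nsmul' b]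
    exact add_mem (nsmul_mem ha m) (nsmul_mem hb n)

lemma le_cone : P ≤ cone P := fun v hv => ⟨1, one_pos, by simpa using hv⟩

lemma inv_smul_mem_cone {v : Fin r → ℚ} (hv : v ∈ cone P) {n : ℕ} (hn : 0 < n) :
    (n : ℚ)⁻¹ • v ∈ cone P := by
  obtain ⟨m, hm, h⟩ := hv
  refine ⟨m * n, Nat.mul_pos hm hn, ?_⟩
  have hn' : (n : ℚ) ≠ 0 := by positivity
  rwa [mul_nsmul', ← Nat.cast_smul_eq_nsmul ℚ n, smul_inv_smul₀ hn']

/-- `Δ_P` is downward closed for the order defined by the cone `P_ℚ`. -/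
lemma mem_Delta_of_add {x y : Fin r → ℚ} (hx : x ∈ cone P) (hy : y ∈ cone P)
    (h : x + y ∈ Delta P) : x ∈ Delta P := by
  refine ⟨hx, ?_⟩
  rintro ⟨q, hq, w, hw, rfl⟩
  exact h.2 ⟨q, hq, w + y, (cone P).add_mem hw hy, by simp only [add_assoc]⟩

lemma exists_bound_Delta (hfg : P.FG) :
    ∃ B : ℚ, ∀ x ∈ Delta P, ∀ i, |x i| ≤ B := by
  obtain ⟨S, rfl⟩ := hfg
  refine ⟨∑ g ∈ S, ∑ i, |g i|, ?_⟩
  rintro x ⟨⟨n, hn, hx⟩, hx'⟩ i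
  obtain ⟨b, -, hb⟩ := AddSubmonoid.mem_closure_finset.1 hx
  have hn' : (0 : ℚ) < n := by exact_mod_cast hn
  have hlt : ∀ g ∈ S, g ≠ 0 → b g < n := by
    intro g hg hg0
    by_contra! hle
    refine hx' ⟨g, ⟨AddSubmonoid.subset_closure hg, hg0⟩, x - g, ⟨n, hn, ?_⟩, by simp⟩
    have : n • (x - g) = (b g - n) • g + ∑ a ∈ S.erase g, b a • a := by
      rw [nsmul_sub, ← hb, ← Finset.add_sum_erase S _ hg]
      obtain ⟨c, hc⟩ := Nat.exists_eq_add_of_le hle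
      rw [hc, Nat.add_sub_cancel_left, add_nsmul]
      abel
    rw [this]
    exact add_mem (nsmul_mem (AddSubmonoid.subset_closure hg) _)
      (sum_mem fun a ha => nsmul_mem
        (AddSubmonoid.subset_closure (Finset.mem_of_mem_erase ha)) _)
  have hxi : (n : ℚ) * x i = ∑ g ∈ S, (b g : ℚ) * g i := by
    simpa using (congrFun hb i).symm
  have hkey : (n : ℚ) * |x i| ≤ n * ∑ g ∈ S, |g i| := by
    calc (n : ℚ) * |x i| = |∑ g ∈ S, (b g : ℚ) * g i| := by
          rw [← hxi, abs_mul, abs_of_pos hn']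
      _ ≤ ∑ g ∈ S, |(b g : ℚ) * g i| := Finset.abs_sum_le_sum_abs _ _
      _ ≤ ∑ g ∈ S, n * |g i| := by
          refine Finset.sum_le_sum fun g hg => ?_
          by_cases hg0 : g = 0
          · simp [hg0]
          · rw [abs_mul, Nat.abs_cast]
            gcongr
            exact (hlt g hg hg0).le
      _ = n * ∑ g ∈ S, |g i| := (Finset.mul_sum _ _ _).symm
  refine (le_of_mul_le_mul_left hkey hn').trans (Finset.sum_le_sum fun g _ => ?_)
  exact Finset.single_le_sum (f := fun i => |g i|) (fun _ _ => abs_nonneg _) (Finset.mem_univ i)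

lemma exists_common_denominator (hfg : P.FG) :
    ∃ D : ℕ, 0 < D ∧ ∀ x ∈ Pgp P, ∀ i, ∃ z : ℤ, (D : ℚ) * x i = z := by
  obtain ⟨S, rfl⟩ := hfg
  refine ⟨∏ g ∈ S, ∏ i, (g i).den,
    Finset.prod_pos fun g _ => Finset.prod_pos fun i _ => (g i).den_pos, ?_⟩
  intro x hx
  have hle : AddSubmonoid.closure (S : Set (Fin r → ℚ)) ≤
      (AddSubgroup.closure (S : Set (Fin r → ℚ))).toAddSubmonoid :=
    AddSubmonoid.closure_le.2 AddSubgroup.subset_closure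
  replace hx : x ∈ AddSubgroup.closure (S : Set (Fin r → ℚ)) :=
    (AddSubgroup.closure_le _).2 hle hx
  induction hx using AddSubgroup.closure_induction with
  | mem g hg =>
    intro i
    obtain ⟨c, hc⟩ : (g i).den ∣ ∏ g ∈ S, ∏ i, (g i).den :=
      (Finset.dvd_prod_of_mem _ (Finset.mem_univ i)).trans
        (Finset.dvd_prod_of_mem (fun g : Fin r → ℚ => ∏ i, (g i).den) hg)
    refine ⟨c * (g i).num, ?_⟩
    rw [hc]
    push_cast
    rw [← Rat.mul_den_eq_num (g i)]
    ring
  | zero => exact fun i => ⟨0, by simp⟩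
  | add a b _ _ ha hb =>
    intro i
    obtain ⟨y, hy⟩ := ha i
    obtain ⟨z, hz⟩ := hb i
    exact ⟨y + z, by rw [Pi.add_apply, mul_add, hy, hz]; push_cast; rfl⟩
  | neg a _ ha =>
    intro i
    obtain ⟨y, hy⟩ := ha i
    exact ⟨-y, by rw [Pi.neg_apply, mul_neg, hy]; push_cast; rfl⟩

lemma finite_Pgp_inter_box (hfg : P.FG) (R : ℚ) :
    {x : Fin r → ℚ | x ∈ Pgp P ∧ ∀ i, |x i| ≤ R}.Finite := by
  obtain ⟨D, hD, hden⟩ := exists_common_denominator hfg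
  have hD' : (0 : ℚ) < D := by exact_mod_cast hD
  have hfin : (Set.pi Set.univ fun _ : Fin r =>
      (fun z : ℤ => (z : ℚ) / D) '' Set.Icc (-⌊D * R⌋) ⌊D * R⌋).Finite :=
    Set.Finite.pi fun _ => (Set.finite_Icc _ _).image _
  refine hfin.subset ?_
  rintro x ⟨hx, hR⟩ i -
  obtain ⟨z, hz⟩ := hden x hx i
  refine ⟨z, ?_, by simp only [← hz]; field_simp⟩
  have hzle : |(z : ℚ)| ≤ D * R := by
    rw [← hz, abs_mul, abs_of_pos hD']
    exact mul_le_mul_of_nonneg_left (hR i) hD'.le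
  rw [Set.mem_Icc, ← abs_le]
  exact Int.le_floor.2 (by push_cast; exact hzle)

lemma finite_coset_inter_box (hfg : P.FG) (R : ℚ) (c : (Fin r → ℚ) ⧸ Pgp P) :
    {x : Fin r → ℚ | (QuotientAddGroup.mk x : (Fin r → ℚ) ⧸ Pgp P) = c ∧
      ∀ i, |x i| ≤ R}.Finite := by
  obtain ⟨c, rfl⟩ := QuotientAddGroup.mk_surjective c
  refine ((finite_Pgp_inter_box hfg (R + ∑ i, |c i|)).image (fun y => c + y)).subset ?_
  rintro x ⟨hx, hR⟩
  refine ⟨-c + x, ⟨QuotientAddGroup.eq.1 hx.symm, fun i => ?_⟩, by simp⟩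
  have h₁ := Finset.single_le_sum (f := fun i => |c i|) (fun _ _ => abs_nonneg _)
    (Finset.mem_univ i)
  have h₂ := abs_add_le (-c i) (x i)
  rw [abs_neg] at h₂
  exact h₂.trans (by linarith [hR i])

/-- Finite sets of points of a bounded box lying in a single class have bounded cardinality,
uniformly in the class. -/
lemma exists_card_bound (hfg : P.FG) (B : ℚ) :
    ∃ C : ℕ, ∀ t : Finset (Fin r → ℚ), ∀ c : (Fin r → ℚ) ⧸ Pgp P,
      (∀ x ∈ t, (QuotientAddGroup.mk x : (Fin r → ℚ) ⧸ Pgp P) = c ∧ ∀ i, |x i| ≤ B) →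
      t.card ≤ C := by
  have hfin := finite_Pgp_inter_box hfg (B + B)
  refine ⟨hfin.toFinset.card, fun t c ht => ?_⟩
  obtain rfl | ⟨y, hy⟩ := t.eq_empty_or_nonempty
  · simp
  refine Finset.card_le_card_of_injOn (fun x => -y + x) (fun x hx => ?_)
    (fun _ _ _ _ h => add_left_cancel h)
  have hx := ht x hx
  have hy := ht y hy
  simp only [Set.Finite.coe_toFinset, Set.mem_ofPred_eq]
  refine ⟨QuotientAddGroup.eq.1 (hy.1.trans hx.1.symm), fun i => ?_⟩
  have h := abs_add_le (-y i) (x i)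
  rw [abs_neg] at h
  exact h.trans (add_le_add (hy.2 i) (hx.2 i))

lemma eq_zero_of_forall_inv_smul_mem (hfg : P.FG) {x : Fin r → ℚ}
    (hx : ∀ n : ℕ, 0 < n → (n : ℚ)⁻¹ • x ∈ Pgp P) : x = 0 := by
  obtain ⟨D, hD, hden⟩ := exists_common_denominator hfg
  have hD' : (0 : ℚ) < D := by exact_mod_cast hD
  funext i
  obtain ⟨n, hn⟩ := exists_nat_gt (D * |x i|)
  have hn' : (0 : ℚ) < n := lt_of_le_of_lt (by positivity) hn
  obtain ⟨z, hz⟩ := hden _ (hx n (by exact_mod_cast hn')) i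
  have hzn : (D : ℚ) * x i = n * z := by
    rw [← hz, Pi.smul_apply, smul_eq_mul]
    field_simp
  have hlt : (n : ℚ) * |(z : ℚ)| < n * 1 := by
    rw [← abs_of_pos hn', ← abs_mul, ← hzn, abs_mul, abs_of_pos hD', abs_of_pos hn', mul_one]
    exact hn
  have hz0 : z = 0 := by
    have := lt_of_mul_lt_mul_left hlt hn'.le
    exact Int.abs_lt_one_iff.1 (by exact_mod_cast this)
  rw [hz0, Int.cast_zero, mul_zero] at hzn
  exact (mul_eq_zero.1 hzn).resolve_left hD'.ne'

/-- Dickson's lemma rules out infinite descent `p, p - g, p - 2g, …` inside `P`. -/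
lemma eventually_sub_nsmul_notMem (hfg : P.FG)
    (hsharp : ∀ v : Fin r → ℚ, v ∈ P → -v ∈ P → v = 0)
    (p : Fin r → ℚ) {g : Fin r → ℚ} (hg : g ∈ P) (hg0 : g ≠ 0) :
    ∀ᶠ m : ℕ in Filter.atTop, p - m • g ∉ P := by
  by_contra hev
  have hfreq : ∃ᶠ m : ℕ in Filter.atTop, p - m • g ∈ P := by
    simpa only [Filter.not_eventually, not_not] using hev
  have hall : ∀ m : ℕ, p - m • g ∈ P := by
    intro m
    obtain ⟨n, hmn, hn⟩ := Filter.frequently_atTop.1 hfreq m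
    obtain ⟨c, rfl⟩ := Nat.exists_eq_add_of_le hmn
    have : p - m • g = (p - (m + c) • g) + c • g := by rw [add_nsmul]; abel
    rw [this]
    exact add_mem hn (nsmul_mem hg c)
  obtain ⟨S, rfl⟩ := hfg
  have hrep := fun m => AddSubmonoid.mem_closure_finset.1 (hall m)
  choose f _ hf using hrep
  obtain ⟨m, n, hmn, hle⟩ := wellQuasiOrdered_le (α := S → ℕ) fun m a => f m a
  have hdiff : (p - n • g) - (p - m • g) = ∑ a ∈ S, (f n a - f m a) • a := by
    rw [← hf n, ← hf m, ← Finset.sum_sub_distrib]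
    refine Finset.sum_congr rfl fun a ha => ?_
    obtain ⟨c, hc⟩ := Nat.exists_eq_add_of_le (hle ⟨a, ha⟩)
    simp only at hc
    rw [hc, Nat.add_sub_cancel_left, add_nsmul]
    abel
  obtain ⟨c, rfl⟩ := Nat.exists_eq_add_of_lt hmn
  refine hg0 (hsharp g hg ?_)
  have hneg : -g = ((p - (m + c + 1) • g) - (p - m • g)) + c • g := by
    rw [add_nsmul, add_nsmul, one_nsmul]
    abel
  rw [hneg, hdiff]
  exact add_mem (sum_mem fun a ha => nsmul_mem (AddSubmonoid.subset_closure ha) _)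
    (nsmul_mem hg c)

/-- Every nonzero element of a generated submonoid dominates a nonzero generator. -/
lemma exists_generator_add {M : Type*} [AddCommMonoid M] {S : Set M} {q : M}
    (hq : q ∈ AddSubmonoid.closure S) (hq0 : q ≠ 0) :
    ∃ g ∈ S, g ≠ 0 ∧ ∃ w ∈ AddSubmonoid.closure S, q = g + w := by
  induction hq using AddSubmonoid.closure_induction with
  | mem g hg => exact ⟨g, hg, hq0, 0, zero_mem _, (add_zero g).symm⟩
  | zero => exact absurd rfl hq0
  | add a b ha hb iha ihb =>
    by_cases ha0 : a = 0
    · subst ha0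
      obtain ⟨g, hg, hg0, w, hw, h⟩ := ihb (by simpa using hq0)
      exact ⟨g, hg, hg0, w, hw, by rw [zero_add, h]⟩
    · obtain ⟨g, hg, hg0, w, hw, h⟩ := iha ha0
      exact ⟨g, hg, hg0, w + b, add_mem hw hb, by rw [h, add_assoc]⟩

lemma exists_inv_smul_mem_Delta (hfg : P.FG)
    (hsharp : ∀ v : Fin r → ℚ, v ∈ P → -v ∈ P → v = 0)
    (hsat : ∀ v : Fin r → ℚ, v ∈ Pgp P → (∃ n : ℕ, 0 < n ∧ n • v ∈ P) → v ∈ P)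
    {p : Fin r → ℚ} (hp : p ∈ P) : ∃ m : ℕ, 0 < m ∧ (m : ℚ)⁻¹ • p ∈ Delta P := by
  obtain ⟨S, hS⟩ := id hfg
  have hSP : ∀ g ∈ S, g ∈ P := fun g hg => hS ▸ AddSubmonoid.subset_closure hg
  have hev : ∀ᶠ m : ℕ in Filter.atTop, ∀ g ∈ S, g ≠ 0 → p - m • g ∉ P := by
    rw [Filter.eventually_all_finset]
    intro g hg
    by_cases hg0 : g = 0
    · simp [hg0]
    · filter_upwards [eventually_sub_nsmul_notMem hfg hsharp p (hSP g hg) hg0] with m hm _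
      exact hm
  obtain ⟨m, hm, hpos⟩ := (hev.and (Filter.eventually_gt_atTop 0)).exists
  refine ⟨m, hpos, inv_smul_mem_cone (le_cone hp) hpos, ?_⟩
  rintro ⟨q, ⟨hq, hq0⟩, w, hw, hqw⟩
  obtain ⟨g, hg, hg0, q', hq', rfl⟩ := exists_generator_add (hS.symm ▸ hq :
    q ∈ AddSubmonoid.closure (S : Set (Fin r → ℚ))) hq0
  rw [hS] at hq'
  refine hm g hg hg0 (hsat _ (sub_mem (AddSubgroup.subset_closure hp)
    (nsmul_mem (AddSubgroup.subset_closure (hSP g hg)) m)) ?_)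
  have hm0 : (m : ℚ) ≠ 0 := by positivity
  have hpm : p = m • (g + q' + w) := by
    simp only at hqw
    rw [hqw, ← Nat.cast_smul_eq_nsmul ℚ m, smul_inv_smul₀ hm0]
  have heq : p - m • g = m • (q' + w) := by
    rw [hpm, add_assoc, nsmul_add g]
    abel
  rw [heq]
  exact nsmul_mem ((cone P).add_mem (le_cone hq') hw) m

lemma isInfiniteQuotient_of_element (hfg : P.FG)
    (hsharp : ∀ v : Fin r → ℚ, v ∈ P → -v ∈ P → v = 0)
    (hsat : ∀ v : Fin r → ℚ, v ∈ Pgp P → (∃ n : ℕ, 0 < n ∧ n • v ∈ P) → v ∈ P)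
    {l : ℕ → (Fin r → ℚ) ⧸ Pgp P} {p : Fin r → ℚ} (hp : p ∈ P)
    (hpl : ∀ n : ℕ, 0 < n → l n = QuotientAddGroup.mk ((n : ℚ)⁻¹ • p)) :
    IsInfiniteQuotient P l := by
  obtain ⟨m, hm, hmD⟩ := exists_inv_smul_mem_Delta hfg hsharp hsat hp
  refine ⟨m, hm, fun j hj => ⟨fun _ => ((j * m : ℕ) : ℚ)⁻¹ • p, ?_⟩⟩
  have hj0 : (j : ℚ) ≠ 0 := by positivity
  have hsum : j • (((j * m : ℕ) : ℚ)⁻¹ • p) = (m : ℚ)⁻¹ • p := by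
    rw [← Nat.cast_smul_eq_nsmul ℚ j, smul_smul]
    push_cast
    rw [mul_inv, mul_inv_cancel_left₀ hj0]
  have hmem := inv_smul_mem_cone (le_cone hp) (Nat.mul_pos hj hm)
  refine ⟨fun _ => ⟨?_, (hpl _ (Nat.mul_pos hj hm)).symm⟩, ?_⟩
  · refine mem_Delta_of_add hmem (nsmul_mem hmem (j - 1)) ?_
    rw [← succ_nsmul', Nat.sub_add_cancel hj, hsum]
    exact hmD
  · rw [Finset.sum_const, Finset.card_univ, Fintype.card_fin, hsum]
    exact hmD

/-- Elements of `Δ_P` of a common class whose sum of `j` terms lies in `Δ_P`: one of them has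
multiplicity proportional to `j`, so that its `j`-th multiple is bounded independently of `j`. -/
lemma exists_nsmul_bound (hfg : P.FG) :
    ∃ R : ℚ, ∀ j : ℕ, 0 < j → ∀ c : (Fin r → ℚ) ⧸ Pgp P, ∀ γ : Fin j → (Fin r → ℚ),
      (∀ i, γ i ∈ Delta P ∧ (QuotientAddGroup.mk (γ i) : (Fin r → ℚ) ⧸ Pgp P) = c) →
      (∑ i, γ i) ∈ Delta P →
      ∃ v ∈ cone P, (QuotientAddGroup.mk v : (Fin r → ℚ) ⧸ Pgp P) = c ∧
        ∀ i, |(j • v) i| ≤ R := by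
  classical
  obtain ⟨B, hB⟩ := exists_bound_Delta hfg
  obtain ⟨C, hC⟩ := exists_card_bound hfg B
  refine ⟨C * B, fun j hj c γ hγ hsum => ?_⟩
  set t := Finset.univ.image γ with ht
  have htC : t.card ≤ C := hC t c fun x hx => by
    obtain ⟨i, -, rfl⟩ := Finset.mem_image.1 hx
    exact ⟨(hγ i).2, hB _ (hγ i).1⟩
  have htne : t.Nonempty := ⟨γ ⟨0, hj⟩, Finset.mem_image_of_mem _ (Finset.mem_univ _)⟩
  have htpos : (0 : ℚ) < t.card := by exact_mod_cast htne.card_pos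
  obtain ⟨v, hv, hk⟩ := Finset.exists_le_card_fiber_of_nsmul_le_card_of_maps_to
    (s := Finset.univ) (f := γ) (b := (j : ℚ) / t.card)
    (fun i hi => Finset.mem_image_of_mem γ hi) htne
    (by rw [nsmul_eq_mul, mul_div_cancel₀ _ htpos.ne']; simp)
  set s := Finset.univ.filter fun i => γ i = v with hs
  obtain ⟨i₀, -, hi₀⟩ := Finset.mem_image.1 hv
  refine ⟨v, hi₀ ▸ (hγ i₀).1.1, hi₀ ▸ (hγ i₀).2, fun i => ?_⟩
  have hsv : ∑ i ∈ s, γ i = s.card • v := by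
    rw [← Finset.sum_const]
    exact Finset.sum_congr rfl fun i hi => (Finset.mem_filter.1 hi).2
  have hmem : ∀ u : Finset (Fin j), ∑ i ∈ u, γ i ∈ cone P :=
    fun u => sum_mem fun i _ => (hγ i).1.1
  have hDelta : s.card • v ∈ Delta P := by
    rw [← hsv]
    refine mem_Delta_of_add (hmem s) (hmem sᶜ) ?_
    rwa [Finset.sum_add_sum_compl]
  have hbound := hB _ hDelta i
  rw [Pi.smul_apply, nsmul_eq_mul, abs_mul, Nat.abs_cast] at hbound ⊢
  have hB0 : 0 ≤ B := le_trans (by positivity) hbound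
  have hjle : (j : ℚ) ≤ t.card * s.card := by
    rwa [div_le_iff₀' htpos] at hk
  calc (j : ℚ) * |v i| ≤ t.card * s.card * |v i| := by gcongr
    _ = t.card * (s.card * |v i|) := mul_assoc _ _ _
    _ ≤ C * B := by gcongr

lemma exists_element_of_isInfiniteQuotient (hfg : P.FG)
    (hsat : ∀ v : Fin r → ℚ, v ∈ Pgp P → (∃ n : ℕ, 0 < n ∧ n • v ∈ P) → v ∈ P)
    {l : ℕ → (Fin r → ℚ) ⧸ Pgp P} (hl : IsCompatible P l) (h : IsInfiniteQuotient P l) :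
    ∃ p : Fin r → ℚ, p ∈ P ∧ ∀ n : ℕ, 0 < n →
      l n = QuotientAddGroup.mk ((n : ℚ)⁻¹ • p) := by
  obtain ⟨m, hm, h⟩ := h
  obtain ⟨R, hR⟩ := exists_nsmul_bound hfg
  have hfin := finite_coset_inter_box hfg R (l m)
  have hdiv : ∀ a b : ℕ, 0 < a → 0 < b → b • l (b * a) = l a := fun a b ha hb => by
    simpa [Nat.mul_div_cancel _ ha] using
      hl.2 a (b * a) ha (Nat.mul_pos hb ha) (dvd_mul_left a b)
  have hex : ∀ j : ℕ, 0 < j → ∃ x ∈ hfin.toFinset, ∃ v ∈ cone P, j • v = x ∧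
      (QuotientAddGroup.mk v : (Fin r → ℚ) ⧸ Pgp P) = l (j * m) := by
    intro j hj
    obtain ⟨γ, hγ, hsum⟩ := h j hj
    obtain ⟨v, hv, hvl, hvR⟩ := hR j hj _ γ hγ hsum
    refine ⟨j • v, hfin.mem_toFinset.2 ⟨?_, hvR⟩, v, hv, rfl, hvl⟩
    rw [QuotientAddGroup.mk_nsmul, hvl, hdiv m j hm hj]
  obtain ⟨x, hx⟩ : ∃ x, ∀ j : ℕ, 0 < j → ∃ v ∈ cone P, j • v = x ∧
      (QuotientAddGroup.mk v : (Fin r → ℚ) ⧸ Pgp P) = l (j * m) := by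
    by_contra! hno
    choose J hJpos hJ using hno
    obtain ⟨x, hx, v, hv, hvx, hvl⟩ := hex (∏ x ∈ hfin.toFinset, J x)
      (Finset.prod_pos fun x _ => hJpos x)
    obtain ⟨c, hc⟩ := Finset.dvd_prod_of_mem J hx
    have hc0 : 0 < c := by
      refine Nat.pos_of_ne_zero ?_
      rintro rfl
      exact (Finset.prod_pos fun x _ => hJpos x).ne' (hc.trans (mul_zero _))
    rw [hc] at hvx hvl
    refine hJ x (c • v) (nsmul_mem hv c) (by rw [← mul_nsmul', hvx]) ?_
    rw [QuotientAddGroup.mk_nsmul, hvl, mul_comm (J x), mul_assoc,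
      hdiv _ c (Nat.mul_pos (hJpos x) hm) hc0]
  have hmx : ∀ n : ℕ, 0 < n → l n = QuotientAddGroup.mk ((n : ℚ)⁻¹ • (m • x)) := by
    intro n hn
    obtain ⟨v, -, rfl, hvl⟩ := hx n hn
    have hn0 : (n : ℚ) ≠ 0 := by positivity
    have heq : (n : ℚ)⁻¹ • (m • n • v) = m • v := by
      rw [smul_comm m n v, ← Nat.cast_smul_eq_nsmul ℚ n, inv_smul_smul₀ hn0]
    rw [heq, QuotientAddGroup.mk_nsmul, hvl, mul_comm n m, hdiv n m hn hm]
  refine ⟨m • x, hsat _ ?_ ?_, hmx⟩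
  · have h1 := hmx 1 one_pos
    rw [hl.1, Nat.cast_one, inv_one, one_smul] at h1
    exact (QuotientAddGroup.eq_zero_iff _).1 h1.symm
  · obtain ⟨v, hv, hvx, -⟩ := hx 1 one_pos
    rw [← hvx]
    exact nsmul_mem (nsmul_mem hv 1) m

end InfiniteQuotient

/-- A compatible family `λ` is an infinite quotient if and only if there is `p ∈ P` with
`λ_n = [(1/n) • p]` for all positive `n`; moreover such a `p` is unique.  Thus the image
of `P` in the group of compatible families is precisely the set of infinite quotients, and
`P` maps bijectively onto the infinite quotients. -/
theorem infiniteQuotient_iff_of_element {r : ℕ} (hr : 0 < r)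
    (P : AddSubmonoid (Fin r → ℚ))
    (hfg : P.FG)
    (hsharp : ∀ v : Fin r → ℚ, v ∈ P → -v ∈ P → v = 0)
    (hsat : ∀ v : Fin r → ℚ, v ∈ Pgp P → (∃ n : ℕ, 0 < n ∧ n • v ∈ P) → v ∈ P)
    (hspan : Submodule.span ℚ (P : Set (Fin r → ℚ)) = ⊤)
    (l : ℕ → (Fin r → ℚ) ⧸ Pgp P)
    (hl : IsCompatible P l) :
    (IsInfiniteQuotient P l ↔
      ∃ p : Fin r → ℚ, p ∈ P ∧ ∀ n : ℕ, 0 < n →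
        l n = QuotientAddGroup.mk ((n : ℚ)⁻¹ • p)) ∧
    (∀ p q : Fin r → ℚ, p ∈ P → q ∈ P →
      (∀ n : ℕ, 0 < n → l n = QuotientAddGroup.mk ((n : ℚ)⁻¹ • p)) →
      (∀ n : ℕ, 0 < n → l n = QuotientAddGroup.mk ((n : ℚ)⁻¹ • q)) →
      p = q) := by
  refine ⟨⟨InfiniteQuotient.exists_element_of_isInfiniteQuotient hfg hsat hl,
    fun ⟨_, hp, hpl⟩ => InfiniteQuotient.isInfiniteQuotient_of_element hfg hsharp hsat hp hpl⟩,
    fun p q _ _ hp hq => ?_⟩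
  have h : -p + q = 0 := InfiniteQuotient.eq_zero_of_forall_inv_smul_mem hfg fun n hn => by
    rw [smul_add, smul_neg]
    exact QuotientAddGroup.eq.1 ((hp n hn).symm.trans (hq n hn))
  exact neg_add_eq_zero.1 h
end

section
/- For every positive integer n, the set Δ_P ∩ {v ∈ ℚ^r : n • v ∈ P^gp} is finite; that is, Δ_P meets each lattice (1/n)·P^gp in only finitely many points. -/
open scoped Pointwise

/-- If `n • v` is a combination of generators in which some nonzero generator has
coefficient at least `n`, then that generator can be split off from `v` inside `P_ℚ`. -/
theorem mem_Pplus_add_PQ {r n : ℕ} (hn : 0 < n) {S : Finset (Fin r → ℚ)}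
    {f : (Fin r → ℚ) → ℕ} {s v : Fin r → ℚ} (hs : s ∈ S) (hs0 : s ≠ 0) (hns : n ≤ f s)
    (hf : ∑ a ∈ S, f a • a = n • v) :
    v ∈ Pplus (AddSubmonoid.closure (S : Set (Fin r → ℚ))) +
      PQ (AddSubmonoid.closure (S : Set (Fin r → ℚ))) := by
  have hmem : ∀ a ∈ S, a ∈ AddSubmonoid.closure (S : Set (Fin r → ℚ)) :=
    fun a ha => AddSubmonoid.subset_closure ha
  refine Set.mem_add.mpr ⟨s, ⟨hmem s hs, hs0⟩, v - s, ⟨n, hn, ?_⟩, add_sub_cancel s v⟩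
  have hsplit : n • (v - s) = (f s - n) • s + ∑ a ∈ S.erase s, f a • a := by
    rw [smul_sub, ← hf, ← Finset.add_sum_erase S _ hs, sub_nsmul s hns]
    abel
  rw [hsplit]
  exact add_mem (nsmul_mem (hmem s hs) _)
    (sum_mem fun a ha => nsmul_mem (hmem a (Finset.mem_of_mem_erase ha)) _)

/-- For every positive integer `n`, `Δ_P` meets the lattice `(1/n)·P^gp` in only finitely
many points. -/
theorem delta_inter_lattice_finite {r : ℕ} (hr : 0 < r) (P : AddSubmonoid (Fin r → ℚ))
    (hfg : P.FG)
    (hsharp : ∀ v : Fin r → ℚ, v ∈ P → -v ∈ P → v = 0)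
    (hsat : ∀ v : Fin r → ℚ, v ∈ Pgp P → (∃ n : ℕ, 0 < n ∧ n • v ∈ P) → v ∈ P)
    (hspan : Submodule.span ℚ (P : Set (Fin r → ℚ)) = ⊤) :
    ∀ n : ℕ, 0 < n →
      (Delta P ∩ {v : Fin r → ℚ | n • v ∈ Pgp P}).Finite := by
  intro n hn
  obtain ⟨S, rfl⟩ := hfg
  refine (Set.finite_range fun c : S → Fin n =>
    (n : ℚ)⁻¹ • ∑ s : S, (c s : ℕ) • (s : Fin r → ℚ)).subset ?_
  rintro v ⟨⟨⟨m, hm, hmv⟩, hv⟩, hnv⟩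
  have hnvP : n • v ∈ AddSubmonoid.closure (S : Set (Fin r → ℚ)) :=
    hsat _ hnv ⟨m, hm, by rw [smul_comm]; exact AddSubmonoid.nsmul_mem _ hmv n⟩
  obtain ⟨f, -, hf⟩ := AddSubmonoid.mem_closure_finset.mp hnvP
  have hlt : ∀ s ∈ S, s ≠ 0 → f s < n := fun s hs hs0 => by
    by_contra! h
    exact hv (mem_Pplus_add_PQ hn hs hs0 h hf)
  refine ⟨fun s => ⟨f s % n, Nat.mod_lt _ hn⟩, ?_⟩
  have hsum : ∑ s : S, (f s % n) • (s : Fin r → ℚ) = n • v := by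
    rw [Finset.sum_coe_sort S fun s => (f s % n) • s, ← hf]
    refine Finset.sum_congr rfl fun s hs => ?_
    rcases eq_or_ne s 0 with rfl | hs0
    · simp
    · rw [Nat.mod_eq_of_lt (hlt s hs hs0)]
  have hn' : (n : ℚ) ≠ 0 := by positivity
  simp only [hsum]
  rw [← Nat.cast_smul_eq_nsmul ℚ, inv_smul_smul₀ hn']
end

section
/- For every v ∈ P_ℚ, the coset slice C := {w ∈ P_ℚ : w − v ∈ P^gp} is finitely generated over P: there exists a finite subset F of C such that C = ⋃_{f ∈ F} (f + P). (This is the combinatorial content of the statement that each graded piece ℤ[P_ℚ]_λ, for λ ∈ P^gp_ℚ/P^gp, is a finitely generated ℤ[P]-module.) -/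
open scoped Pointwise

/-- For every `v ∈ P_ℚ`, the coset slice `C = {w ∈ P_ℚ | w − v ∈ P^gp}` is a finite union
of translates `f + P` with `f ∈ C`. -/
theorem coset_slice_finitely_generated {r : ℕ} (hr : 0 < r) (P : AddSubmonoid (Fin r → ℚ))
    (hfg : P.FG)
    (hsharp : ∀ v : Fin r → ℚ, v ∈ P → -v ∈ P → v = 0)
    (hsat : ∀ v : Fin r → ℚ, v ∈ Pgp P → (∃ n : ℕ, 0 < n ∧ n • v ∈ P) → v ∈ P)
    (hspan : Submodule.span ℚ (P : Set (Fin r → ℚ)) = ⊤)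
    (v : Fin r → ℚ) (hv : v ∈ PQ P) :
    ∃ F : Finset (Fin r → ℚ),
      (F : Set (Fin r → ℚ)) ⊆ {w | w ∈ PQ P ∧ w - v ∈ Pgp P} ∧
      {w | w ∈ PQ P ∧ w - v ∈ Pgp P} = ⋃ f ∈ F, {w | ∃ p ∈ P, w = f + p} := by
  obtain ⟨S, hS⟩ := hfg
  obtain ⟨N, hN, hNv⟩ := hv
  have hle : ∀ x ∈ P, x ∈ Pgp P := fun x hx => AddSubgroup.subset_closure hx
  have hgen : ∀ g ∈ S, g ∈ P := fun g hg => hS ▸ AddSubmonoid.subset_closure hg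
  let R : Set (Fin r → ℚ) := Set.range fun c : S → Fin N => ∑ g : S, (c g : ℕ) • (g : Fin r → ℚ)
  have hinj : Function.Injective fun f : Fin r → ℚ => N • f := nsmul_right_injective hN.ne'
  have hfin : {f | (f ∈ PQ P ∧ f - v ∈ Pgp P) ∧ N • f ∈ R}.Finite :=
    ((Set.finite_range _).preimage hinj.injOn).subset fun f hf => hf.2
  refine ⟨hfin.toFinset, fun f hf => (hfin.mem_toFinset.1 hf).1, ?_⟩
  ext w
  simp only [Set.mem_iUnion, exists_prop, hfin.mem_toFinset, Set.mem_ofPred_eq]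
  constructor
  · rintro ⟨⟨n, hn, hnw⟩, hwv⟩
    have hNw : N • w ∈ P := by
      refine hsat _ ?_ ⟨n, hn, ?_⟩
      · have h := (Pgp P).add_mem ((Pgp P).nsmul_mem hwv N) (hle _ hNv)
        rwa [← nsmul_add, sub_add_cancel] at h
      · rw [nsmul_left_comm]
        exact P.nsmul_mem hnw N
    rw [← hS, AddSubmonoid.mem_closure_finset] at hNw
    obtain ⟨b, -, hb⟩ := hNw
    have hp : ∑ g ∈ S, (b g / N) • g ∈ P :=
      P.sum_mem fun g hg => P.nsmul_mem (hgen g hg) _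
    have hNf : N • (w - ∑ g ∈ S, (b g / N) • g) = ∑ g ∈ S, (b g % N) • g := by
      rw [nsmul_sub, ← hb, Finset.smul_sum, ← Finset.sum_sub_distrib]
      refine Finset.sum_congr rfl fun g _ => ?_
      rw [sub_eq_iff_eq_add, smul_smul, ← add_smul, Nat.mod_add_div]
    refine ⟨w - ∑ g ∈ S, (b g / N) • g, ⟨⟨⟨N, hN, ?_⟩, ?_⟩, ?_⟩, _, hp, (sub_add_cancel _ _).symm⟩
    · rw [hNf]
      exact P.sum_mem fun g hg => P.nsmul_mem (hgen g hg) _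
    · rw [sub_right_comm]
      exact (Pgp P).sub_mem hwv (hle _ hp)
    · rw [hNf]
      exact ⟨fun g => ⟨b g % N, Nat.mod_lt _ hN⟩, Finset.sum_coe_sort S fun g => (b g % N) • g⟩
  · rintro ⟨f, ⟨⟨⟨n, hn, hnf⟩, hfv⟩, -⟩, p, hp, rfl⟩
    refine ⟨⟨n, hn, ?_⟩, ?_⟩
    · rw [nsmul_add]
      exact P.add_mem hnf (P.nsmul_mem hp n)
    · rw [add_sub_right_comm]
      exact (Pgp P).add_mem hfv (hle _ hp)
end

section
/- Let Λ be a torsion additive abelian group, let R and A be Λ-graded commutative rings, and let φ : R → A be a degree-preserving ring homomorphism (φ(R_λ) ⊆ A_λ for all λ ∈ Λ) making A into a finitely presented R-algebra. Then there exists a finite subgroup Λ₀ of Λ such that for every finite subgroup Λ' of Λ containing Λ₀ the following hold: (a) the subring A_{Λ'} is a finitely presented R_{Λ'}-algebra; (b) the natural map A_{Λ'} ⊗_{R_{Λ'}} R → A is an isomorphism; (c) if A is flat as an R-module, then A_{Λ'} is flat as an R_{Λ'}-module. -/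
/-- For a `Λ`-graded ring `S` (graded by the additive subgroups `𝒮 l`) and a subgroup
`Λ' ≤ Λ`, the subring `S_{Λ'} = ⊕_{l ∈ Λ'} S_l` of elements of degrees in `Λ'`,
realized as the subring generated by the homogeneous elements of degrees in `Λ'`. -/
def degSubring {Λ S : Type} [AddCommGroup Λ] [CommRing S]
    (𝒮 : Λ → AddSubgroup S) (Λ' : AddSubgroup Λ) : Subring S :=
  Subring.closure (⋃ l ∈ Λ', (𝒮 l : Set S))

/-- A ring map `R₀ → R` with an `R₀`-linear retraction `π`, together with an `A₀`-linear
retraction `ρ` of `A₀ → A` compatible with `π`: the setting in which a presentation of `A`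
over `R` with coefficients in `R₀` and generators in `A₀` descends to `A₀` over `R₀`. -/
structure CompatibleRetractions (R₀ R A₀ A : Type*) [CommRing R₀] [CommRing R] [CommRing A₀]
    [CommRing A] [Algebra R₀ R] [Algebra R₀ A₀] [Algebra R A] [Algebra A₀ A] where
  /-- The retraction on base rings. -/
  base : R →ₗ[R₀] R₀
  /-- The retraction on algebras. -/
  top : A →ₗ[A₀] A₀
  base_algebraMap : ∀ r, base (algebraMap R₀ R r) = r
  top_algebraMap : ∀ a, top (algebraMap A₀ A a) = a
  top_base : ∀ r, top (algebraMap R A r) = algebraMap R₀ A₀ (base r)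

namespace CompatibleRetractions

open MvPolynomial TensorProduct

variable {R₀ R A₀ A : Type*} [CommRing R₀] [CommRing R] [CommRing A₀]
  [CommRing A] [Algebra R₀ R] [Algebra R₀ A₀] [Algebra R A] [Algebra A₀ A]

/-- The retraction of polynomial rings obtained by retracting coefficients. -/
noncomputable def mvPolynomial (c : CompatibleRetractions R₀ R A₀ A) (σ : Type*) :
    MvPolynomial σ R →+ MvPolynomial σ R₀ where
  toFun p := AddMonoidAlgebra.map c.base.toAddMonoidHom p
  map_zero' := by ext; simp
  map_add' p q := by ext; simp

@[simp]
theorem coeff_mvPolynomial (c : CompatibleRetractions R₀ R A₀ A) {σ : Type*}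
    (p : MvPolynomial σ R) (m : σ →₀ ℕ) : coeff m (c.mvPolynomial σ p) = c.base (coeff m p) := by
  simp [mvPolynomial]

theorem mvPolynomial_mul_map (c : CompatibleRetractions R₀ R A₀ A) {σ : Type*}
    (p : MvPolynomial σ R) (q : MvPolynomial σ R₀) :
    c.mvPolynomial σ (p * map (algebraMap R₀ R) q) = c.mvPolynomial σ p * q := by
  classical
  ext m
  simp only [coeff_mvPolynomial, coeff_mul, map_sum, coeff_map]
  refine Finset.sum_congr rfl fun x _ => ?_
  rw [mul_comm, ← Algebra.smul_def, map_smul, smul_eq_mul, mul_comm]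

theorem mvPolynomial_map (c : CompatibleRetractions R₀ R A₀ A) {σ : Type*}
    (q : MvPolynomial σ R₀) : c.mvPolynomial σ (map (algebraMap R₀ R) q) = q := by
  ext m
  rw [coeff_mvPolynomial, coeff_map, c.base_algebraMap]

theorem mvPolynomial_monomial (c : CompatibleRetractions R₀ R A₀ A) {σ : Type*}
    (m : σ →₀ ℕ) (r : R) : c.mvPolynomial σ (monomial m r) = monomial m (c.base r) := by
  classical
  ext k
  simp only [coeff_mvPolynomial, coeff_monomial]
  split_ifs <;> simp

variable [Algebra R₀ A] [IsScalarTower R₀ R A] [IsScalarTower R₀ A₀ A]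

variable {σ : Type*} {f : MvPolynomial σ R →ₐ[R] A} {a₀ : σ → A₀}

omit [Algebra R₀ A] [IsScalarTower R₀ R A] [IsScalarTower R₀ A₀ A] in
theorem top_apply (c : CompatibleRetractions R₀ R A₀ A)
    (ha : ∀ i, f (X i) = algebraMap A₀ A (a₀ i)) (p : MvPolynomial σ R) :
    c.top (f p) = aeval a₀ (c.mvPolynomial σ p) := by
  induction p using MvPolynomial.induction_on' with
  | monomial m r =>
    have hm : f (monomial m r)
        = algebraMap A₀ A (m.prod fun i k => a₀ i ^ k) * algebraMap R A r := by
      rw [aeval_unique f, aeval_monomial, mul_comm]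
      simp [ha, Finsupp.prod]
    rw [hm, ← Algebra.smul_def, map_smul, c.top_base, mvPolynomial_monomial, aeval_monomial,
      smul_eq_mul, mul_comm]
  | add p q hp hq => simp [hp, hq]

theorem algebraMap_aeval (ha : ∀ i, f (X i) = algebraMap A₀ A (a₀ i)) (q : MvPolynomial σ R₀) :
    algebraMap A₀ A (aeval a₀ q) = f (map (algebraMap R₀ R) q) := by
  rw [aeval_unique f, aeval_map_algebraMap, ← aeval_algebraMap_apply]
  simp [ha, Function.comp_def]

omit [Algebra R₀ A] [IsScalarTower R₀ R A] [IsScalarTower R₀ A₀ A] in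
theorem aeval_surjective (c : CompatibleRetractions R₀ R A₀ A)
    (ha : ∀ i, f (X i) = algebraMap A₀ A (a₀ i)) (hf : Function.Surjective f) :
    Function.Surjective (aeval a₀ : MvPolynomial σ R₀ →ₐ[R₀] A₀) := by
  intro b
  obtain ⟨p, hp⟩ := hf (algebraMap A₀ A b)
  exact ⟨c.mvPolynomial σ p, by rw [← c.top_apply ha, hp, c.top_algebraMap]⟩

theorem ker_aeval (c : CompatibleRetractions R₀ R A₀ A)
    (ha : ∀ i, f (X i) = algebraMap A₀ A (a₀ i)) {s : Set (MvPolynomial σ R₀)}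
    (hs : Ideal.span (map (algebraMap R₀ R) '' s) = RingHom.ker f) :
    RingHom.ker (aeval a₀ : MvPolynomial σ R₀ →ₐ[R₀] A₀) = Ideal.span s := by
  apply le_antisymm
  · intro q hq
    have hq' : map (algebraMap R₀ R) q ∈ Ideal.span (map (algebraMap R₀ R) '' s) := by
      rw [hs, RingHom.mem_ker, ← algebraMap_aeval ha, RingHom.mem_ker.1 hq, map_zero]
    rw [← c.mvPolynomial_map q]
    generalize map (algebraMap R₀ R) q = p at hq'
    induction hq' using Submodule.closure_induction with
    | zero => simp
    | add p q _ _ hp hq => exact map_add (c.mvPolynomial σ) p q ▸ add_mem hp hq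
    | smul_mem p _ h =>
      obtain ⟨q, hq, rfl⟩ := h
      rw [smul_eq_mul, mvPolynomial_mul_map]
      exact Ideal.mul_mem_left _ _ (Ideal.subset_span hq)
  · rw [Ideal.span_le]
    intro q hq
    have h : f (map (algebraMap R₀ R) q) = 0 := by
      rw [← RingHom.mem_ker, ← hs]
      exact Ideal.subset_span ⟨q, hq, rfl⟩
    rw [← algebraMap_aeval ha] at h
    rw [SetLike.mem_coe, RingHom.mem_ker, ← c.top_algebraMap (aeval a₀ q), h, map_zero]

theorem finitePresentation [Finite σ] (c : CompatibleRetractions R₀ R A₀ A)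
    (ha : ∀ i, f (X i) = algebraMap A₀ A (a₀ i)) (hf : Function.Surjective f)
    {s : Set (MvPolynomial σ R₀)} (hfin : s.Finite)
    (hs : Ideal.span (map (algebraMap R₀ R) '' s) = RingHom.ker f) :
    Algebra.FinitePresentation R₀ A₀ := by
  refine .of_surjective (c.aeval_surjective ha hf) ?_
  have : (Ideal.span s).FG := ⟨hfin.toFinset, by simp⟩
  rwa [← c.ker_aeval ha hs] at this

theorem productMap_bijective (c : CompatibleRetractions R₀ R A₀ A)
    (ha : ∀ i, f (X i) = algebraMap A₀ A (a₀ i)) (hf : Function.Surjective f)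
    {s : Set (MvPolynomial σ R₀)}
    (hs : Ideal.span (map (algebraMap R₀ R) '' s) = RingHom.ker f)
    (i : A₀ →ₐ[R₀] A) (j : R →ₐ[R₀] A) (hi : ∀ a, i a = algebraMap A₀ A a)
    (hj : ∀ r, j r = algebraMap R A r) :
    Function.Bijective (Algebra.TensorProduct.productMap i j) := by
  let g : MvPolynomial σ R →+* A₀ ⊗[R₀] R :=
    eval₂Hom (Algebra.TensorProduct.includeRight : R →ₐ[R₀] A₀ ⊗[R₀] R).toRingHom
      (fun k => a₀ k ⊗ₜ 1)
  have hg : ∀ q : MvPolynomial σ R₀, g (map (algebraMap R₀ R) q) = aeval a₀ q ⊗ₜ 1 := by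
    intro q
    induction q using MvPolynomial.induction_on with
    | C r => simp [g, Algebra.TensorProduct.tmul_one_eq_one_tmul]
    | add p q hp hq => simp [hp, hq, TensorProduct.add_tmul]
    | mul_X p k hp => rw [map_mul, map_mul, hp]; simp [g]
  have hfg : ∀ p, Algebra.TensorProduct.productMap i j (g p) = f p := by
    intro p
    induction p using MvPolynomial.induction_on with
    | C r => simp [g, hj, ← algebraMap_eq]
    | add p q hp hq => simp [hp, hq]
    | mul_X p k hp => rw [map_mul, map_mul, hp]; simp [g, hi, ha]
  have hker : RingHom.ker f ≤ RingHom.ker g := by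
    rw [← hs, Ideal.span_le]
    rintro _ ⟨q, hq, rfl⟩
    have : aeval a₀ q = 0 := by
      rw [← RingHom.mem_ker, c.ker_aeval ha hs]
      exact Ideal.subset_span hq
    simp [hg, this]
  have hgs : Function.Surjective g := by
    intro t
    induction t using TensorProduct.induction_on with
    | zero => exact ⟨0, map_zero g⟩
    | tmul a r =>
      obtain ⟨q, rfl⟩ := c.aeval_surjective ha hf a
      exact ⟨map (algebraMap R₀ R) q * C r, by rw [map_mul, hg]; simp [g]⟩
    | add x y hx hy =>
      obtain ⟨p, rfl⟩ := hx
      obtain ⟨q, rfl⟩ := hy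
      exact ⟨p + q, map_add g p q⟩
  refine ⟨(injective_iff_map_eq_zero _).2 fun t ht => ?_, fun a => ?_⟩
  · obtain ⟨p, rfl⟩ := hgs t
    rw [hfg] at ht
    exact hker ht
  · obtain ⟨p, rfl⟩ := hf a
    exact ⟨g p, hfg p⟩

theorem flat (c : CompatibleRetractions R₀ R A₀ A)
    (hspan : Submodule.span R (Set.range (algebraMap A₀ A)) = ⊤) [Module.Flat R A] :
    Module.Flat R₀ A₀ := by
  refine Module.Flat.of_forall_isTrivialRelation fun {l r x} hrx => ?_
  have hrel : ∑ i, algebraMap R₀ R (r i) • algebraMap A₀ A (x i) = 0 := by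
    simpa [Algebra.smul_def, ← IsScalarTower.algebraMap_apply] using
      congrArg (algebraMap A₀ A) hrx
  obtain ⟨k, b, y, hy, hb⟩ := Module.Flat.isTrivialRelation_of_sum_smul_eq_zero
    (f := fun i => algebraMap R₀ R (r i)) hrel
  have hmem : ∀ j, ∃ w : A₀ →₀ R, (w.sum fun z t => t • algebraMap A₀ A z) = y j := fun j =>
    Finsupp.mem_span_range_iff_exists_finsupp.1 (hspan ▸ Submodule.mem_top)
  choose w hw using hmem
  classical
  let T : Finset A₀ := Finset.univ.biUnion fun j => (w j).support
  have hyT : ∀ j, y j = ∑ z ∈ T, w j z • algebraMap A₀ A z := fun j => by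
    rw [← hw j]
    exact Finsupp.sum_of_support_subset _
      (Finset.subset_biUnion_of_mem (fun j => (w j).support) (Finset.mem_univ j)) _ (by simp)
  let e := T.equivFin.symm
  refine ⟨T.card, fun i z => c.base (∑ j, b i j * w j (e z)), fun z => e z, fun i => ?_,
    fun z => ?_⟩
  · rw [e.sum_comp fun z : T => c.base (∑ j, b i j * w j z) • (z : A₀),
      Finset.sum_coe_sort T fun z => c.base (∑ j, b i j * w j z) • z,
      ← c.top_algebraMap (x i), show algebraMap A₀ A (x i) = _ from hy i]
    simp only [hyT, Finset.smul_sum, smul_smul]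
    rw [Finset.sum_comm, map_sum]
    refine Finset.sum_congr rfl fun z _ => ?_
    rw [← Finset.sum_smul, Algebra.smul_def, mul_comm, ← Algebra.smul_def, map_smul,
      c.top_base, Algebra.smul_def (c.base _) z, smul_eq_mul, mul_comm]
  · simp only [← smul_eq_mul (r _), ← map_smul, ← map_sum]
    rw [← map_zero c.base]
    congr 1
    simp only [Algebra.smul_def, Finset.mul_sum, ← mul_assoc]
    rw [Finset.sum_comm]
    simp [← Finset.sum_mul, hb]

end CompatibleRetractions

section DegreeProjection

open DirectSum

variable {Λ S : Type} [AddCommGroup Λ] [CommRing S] (𝒮 : Λ → AddSubgroup S)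

theorem mem_degSubring_of_mem {Λ' : AddSubgroup Λ} {l : Λ} (hl : l ∈ Λ') {x : S}
    (hx : x ∈ 𝒮 l) : x ∈ degSubring 𝒮 Λ' :=
  Subring.subset_closure (Set.mem_biUnion hl hx)

variable [DecidableEq Λ] [GradedRing 𝒮]

open scoped Classical in
theorem mem_degSubring_of_support_subset {Λ' : AddSubgroup Λ} {x : S}
    (hx : ((decompose 𝒮 x).support : Set Λ) ⊆ Λ') : x ∈ degSubring 𝒮 Λ' := by
  rw [← sum_support_decompose 𝒮 x]
  exact sum_mem fun l hl => mem_degSubring_of_mem 𝒮 (hx hl) (SetLike.coe_mem _)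

open scoped Classical in
/-- A finite set of elements involves only finitely many degrees. -/
theorem exists_finite_subset_degSubring {X : Set S} (hX : X.Finite) :
    ∃ T : Set Λ, T.Finite ∧ ∀ Λ' : AddSubgroup Λ, T ⊆ Λ' → X ⊆ degSubring 𝒮 Λ' :=
  ⟨⋃ x ∈ X, ((decompose 𝒮 x).support : Set Λ), hX.biUnion fun _ _ => Finset.finite_toSet _,
    fun _ hT _ hx => mem_degSubring_of_support_subset 𝒮
      ((Set.subset_biUnion_of_mem (u := fun x => ((decompose 𝒮 x).support : Set Λ)) hx).trans hT)⟩

open scoped Classical in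
/-- The projection onto the components of degrees in `Λ'`. -/
noncomputable def degProj (Λ' : AddSubgroup Λ) : S →+ S :=
  (DirectSum.toAddMonoid fun l => if l ∈ Λ' then (𝒮 l).subtype else 0).comp
    (decomposeAddEquiv 𝒮).toAddMonoidHom

open scoped Classical in
theorem degProj_of_mem (Λ' : AddSubgroup Λ) {l : Λ} {x : S} (hx : x ∈ 𝒮 l) :
    degProj 𝒮 Λ' x = if l ∈ Λ' then x else 0 := by
  simp only [degProj, AddMonoidHom.comp_apply, AddEquiv.coe_toAddMonoidHom,
    decomposeAddEquiv_apply, decompose_of_mem 𝒮 hx, DirectSum.toAddMonoid_of]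
  split_ifs <;> rfl

theorem degProj_mem (Λ' : AddSubgroup Λ) (x : S) : degProj 𝒮 Λ' x ∈ degSubring 𝒮 Λ' := by
  induction x using Decomposition.inductionOn 𝒮 with
  | zero => simp
  | @homogeneous l m =>
    rw [degProj_of_mem 𝒮 Λ' m.2]
    split_ifs with h
    · exact mem_degSubring_of_mem 𝒮 h m.2
    · exact zero_mem _
  | add x y hx hy => exact map_add (degProj 𝒮 Λ') x y ▸ add_mem hx hy

theorem degProj_mul {Λ' : AddSubgroup Λ} {x : S} (hx : x ∈ degSubring 𝒮 Λ') (y : S) :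
    degProj 𝒮 Λ' (x * y) = x * degProj 𝒮 Λ' y := by
  induction hx using Subring.closure_induction generalizing y with
  | mem x hx =>
    obtain ⟨l, hl, hx⟩ := Set.mem_iUnion₂.1 hx
    induction y using Decomposition.inductionOn 𝒮 with
    | zero => simp
    | @homogeneous k m =>
      rw [degProj_of_mem 𝒮 Λ' m.2, degProj_of_mem 𝒮 Λ' (SetLike.mul_mem_graded hx m.2)]
      classical
      rw [mul_ite, mul_zero]
      exact if_congr (AddSubgroup.add_mem_cancel_left Λ' hl) rfl rfl
    | add y z hy hz => simp [mul_add, hy, hz]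
  | zero => simp
  | one => simp
  | add x z _ _ hx hz => simp [add_mul, hx, hz]
  | neg x _ hx => simp [hx]
  | mul x z _ _ hx hz => rw [mul_assoc, hx, hz, mul_assoc]

theorem degProj_of_mem_degSubring {Λ' : AddSubgroup Λ} {x : S} (hx : x ∈ degSubring 𝒮 Λ') :
    degProj 𝒮 Λ' x = x := by
  have h := degProj_mul 𝒮 hx 1
  rwa [degProj_of_mem 𝒮 Λ' SetLike.GradedOne.one_mem, if_pos Λ'.zero_mem, mul_one] at h

/-- `degProj` as a linear retraction of the inclusion of `degSubring`. -/
noncomputable def degRetraction (Λ' : AddSubgroup Λ) : S →ₗ[degSubring 𝒮 Λ'] degSubring 𝒮 Λ' where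
  toFun x := ⟨degProj 𝒮 Λ' x, degProj_mem 𝒮 Λ' x⟩
  map_add' x y := Subtype.ext (map_add _ x y)
  map_smul' x y := Subtype.ext (degProj_mul 𝒮 x.2 y)

theorem degProj_map {A : Type} [CommRing A] (𝒜 : Λ → AddSubgroup A) [GradedRing 𝒜] (φ : S →+* A)
    (hφ : ∀ l, ∀ x ∈ 𝒮 l, φ x ∈ 𝒜 l) (Λ' : AddSubgroup Λ) (x : S) :
    degProj 𝒜 Λ' (φ x) = φ (degProj 𝒮 Λ' x) := by
  induction x using Decomposition.inductionOn 𝒮 with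
  | zero => simp
  | @homogeneous l m =>
    rw [degProj_of_mem 𝒮 Λ' m.2, degProj_of_mem 𝒜 Λ' (hφ l m m.2)]
    split_ifs <;> simp
  | add x y hx hy => simp [hx, hy]

end DegreeProjection

theorem IsAddTorsion.finite_closure {G : Type*} [AddCommGroup G] (hG : IsAddTorsion G)
    {T : Set G} (hT : T.Finite) : (AddSubgroup.closure T : Set G).Finite := by
  have : Finite T := hT
  have : Finite (AddSubgroup.closure T) :=
    AddCommGroup.finite_of_fg_isAddTorsion _ (hG.addSubgroup _)
  exact Set.toFinite _

/-- Let `Λ` be a torsion abelian group, `R` and `A` two `Λ`-graded commutative rings, and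
`φ : R → A` a degree-preserving ring homomorphism making `A` a finitely presented
`R`-algebra.  Then there is a finite subgroup `Λ₀ ≤ Λ` such that for every finite subgroup
`Λ' ⊇ Λ₀`: (a) `A_{Λ'}` is a finitely presented `R_{Λ'}`-algebra; (b) the natural map
`A_{Λ'} ⊗_{R_{Λ'}} R → A` is bijective; (c) if `A` is flat over `R` then `A_{Λ'}` is flat
over `R_{Λ'}`. -/
theorem graded_finitePresentation_descends {Λ : Type} [AddCommGroup Λ] [DecidableEq Λ]
    {R A : Type} [CommRing R] [CommRing A]
    (ℛ : Λ → AddSubgroup R) (𝒜 : Λ → AddSubgroup A)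
    [GradedRing ℛ] [GradedRing 𝒜]
    (htors : AddMonoid.IsTorsion Λ)
    (φ : R →+* A)
    (hdeg : ∀ (l : Λ) (x : R), x ∈ ℛ l → φ x ∈ 𝒜 l)
    (hfp : @Algebra.FinitePresentation R A _ _ φ.toAlgebra) :
    ∃ Λ₀ : AddSubgroup Λ, (Λ₀ : Set Λ).Finite ∧
      ∀ Λ' : AddSubgroup Λ, (Λ' : Set Λ).Finite → Λ₀ ≤ Λ' →
        ∀ h : ∀ x : degSubring ℛ Λ', φ (x : R) ∈ degSubring 𝒜 Λ',
          letI : Algebra (degSubring ℛ Λ') (degSubring 𝒜 Λ') :=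
            ((φ.comp (degSubring ℛ Λ').subtype).codRestrict (degSubring 𝒜 Λ') h).toAlgebra
          letI : Algebra (degSubring ℛ Λ') A :=
            (φ.comp (degSubring ℛ Λ').subtype).toAlgebra
          letI : Algebra (degSubring ℛ Λ') R := (degSubring ℛ Λ').subtype.toAlgebra
          Algebra.FinitePresentation (degSubring ℛ Λ') (degSubring 𝒜 Λ') ∧
          Function.Bijective
            (Algebra.TensorProduct.productMap
              (⟨(degSubring 𝒜 Λ').subtype, fun c => rfl⟩ :
                degSubring 𝒜 Λ' →ₐ[degSubring ℛ Λ'] A)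
              (⟨φ, fun c => rfl⟩ : R →ₐ[degSubring ℛ Λ'] A)) ∧
          ((@Module.Flat R A _ _ (@Algebra.toModule R A _ _ φ.toAlgebra)) →
            Module.Flat (degSubring ℛ Λ') (degSubring 𝒜 Λ')) := by
  let _ := φ.toAlgebra
  obtain ⟨n, f, hf, s, hs⟩ := hfp
  obtain ⟨T₁, hT₁, hT₁'⟩ := exists_finite_subset_degSubring 𝒜
    (Set.finite_range fun i => f (MvPolynomial.X i))
  obtain ⟨T₂, hT₂, hT₂'⟩ := exists_finite_subset_degSubring ℛ
    (s.finite_toSet.biUnion fun p _ => p.coeffs.finite_toSet)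
  refine ⟨AddSubgroup.closure (T₁ ∪ T₂), htors.finite_closure (hT₁.union hT₂),
    fun Λ' _ hΛ' h => ?_⟩
  let _ : Algebra (degSubring ℛ Λ') (degSubring 𝒜 Λ') :=
    ((φ.comp (degSubring ℛ Λ').subtype).codRestrict (degSubring 𝒜 Λ') h).toAlgebra
  let _ : Algebra (degSubring ℛ Λ') A := (φ.comp (degSubring ℛ Λ').subtype).toAlgebra
  let _ : Algebra (degSubring ℛ Λ') R := (degSubring ℛ Λ').subtype.toAlgebra
  have hT := (AddSubgroup.closure_le _).1 hΛ'
  have hX : ∀ i, f (.X i) ∈ degSubring 𝒜 Λ' := fun i =>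
    hT₁' Λ' (Set.subset_union_left.trans hT) ⟨i, rfl⟩
  have hcoeff : ∀ p ∈ s, p ∈ Set.range
      (MvPolynomial.map (σ := Fin n) (algebraMap (degSubring ℛ Λ') R)) := by
    intro p hp
    rw [MvPolynomial.mem_range_map_iff_coeffs_subset]
    intro x hx
    exact ⟨⟨x, hT₂' Λ' (Set.subset_union_right.trans hT) (Set.mem_biUnion hp hx)⟩, rfl⟩
  let t := MvPolynomial.map (σ := Fin n) (algebraMap (degSubring ℛ Λ') R) ⁻¹' s
  have ht : t.Finite := s.finite_toSet.preimage
    (MvPolynomial.map_injective _ (degSubring ℛ Λ').subtype_injective).injOn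
  have hker : Ideal.span (MvPolynomial.map (algebraMap (degSubring ℛ Λ') R) '' t)
      = RingHom.ker f := by
    rw [Set.image_preimage_eq_of_subset hcoeff]
    exact hs
  have : IsScalarTower (degSubring ℛ Λ') R A := .of_algebraMap_eq fun _ => rfl
  have : IsScalarTower (degSubring ℛ Λ') (degSubring 𝒜 Λ') A := .of_algebraMap_eq fun _ => rfl
  let c : CompatibleRetractions (degSubring ℛ Λ') R (degSubring 𝒜 Λ') A :=
    { base := degRetraction ℛ Λ'
      top := degRetraction 𝒜 Λ'
      base_algebraMap := fun r => Subtype.ext (degProj_of_mem_degSubring ℛ r.2)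
      top_algebraMap := fun a => Subtype.ext (degProj_of_mem_degSubring 𝒜 a.2)
      top_base := fun r => Subtype.ext (degProj_map ℛ 𝒜 φ hdeg Λ' r) }
  have ha : ∀ i, f (.X i) = algebraMap (degSubring 𝒜 Λ') A ⟨f (.X i), hX i⟩ := fun _ => rfl
  have hbij := c.productMap_bijective ha hf hker ⟨(degSubring 𝒜 Λ').subtype, fun c => rfl⟩
    ⟨φ, fun c => rfl⟩ (fun _ => rfl) (fun _ => rfl)
  refine ⟨c.finitePresentation ha hf ht hker, hbij, fun hflat => c.flat ?_⟩
  refine eq_top_iff.2 fun a _ => ?_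
  obtain ⟨z, rfl⟩ := hbij.2 a
  induction z using TensorProduct.induction_on with
  | zero => simp
  | tmul b r =>
    rw [Algebra.TensorProduct.productMap_apply_tmul, mul_comm]
    exact Submodule.smul_mem _ r (Submodule.subset_span ⟨b, rfl⟩)
  | add x y hx hy =>
    rw [map_add]
    exact add_mem (hx trivial) (hy trivial)
end

section
/- Let Q₀ := {(a₁,a₂,a₃) ∈ ℚ³ : a₁ ≥ 0, a₂ ≥ 0, a₁ + a₃ ≥ 0, a₂ + a₃ ≥ 0} and A := {(a₁,a₂,a₃) ∈ ℚ³ : a₁ ≥ 0, a₂ ≥ 0, a₁ + a₃ ≥ 0, a₂ + a₃ ≥ 1}. Then A is an ideal of the monoid Q₀ (that is, A ⊆ Q₀ and A + Q₀ ⊆ A) which is not finitely generated: there is no finite subset F of A such that A = ⋃_{f ∈ F} (f + Q₀). -/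
/-- The monoid `Q₀ = {(a₁,a₂,a₃) ∈ ℚ³ | a₁ ≥ 0, a₂ ≥ 0, a₁+a₃ ≥ 0, a₂+a₃ ≥ 0}`. -/
def Qzero : Set (Fin 3 → ℚ) :=
  {a | 0 ≤ a 0 ∧ 0 ≤ a 1 ∧ 0 ≤ a 0 + a 2 ∧ 0 ≤ a 1 + a 2}

/-- The set `A = {(a₁,a₂,a₃) ∈ ℚ³ | a₁ ≥ 0, a₂ ≥ 0, a₁+a₃ ≥ 0, a₂+a₃ ≥ 1}`. -/
def Aideal : Set (Fin 3 → ℚ) :=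
  {a | 0 ≤ a 0 ∧ 0 ≤ a 1 ∧ 0 ≤ a 0 + a 2 ∧ 1 ≤ a 1 + a 2}

/-- Every point `(0, t, 1 - t)` with `0 ≤ t ≤ 1` lies in `A`. -/
theorem segment_mem_Aideal {t : ℚ} (h0 : 0 ≤ t) (h1 : t ≤ 1) : ![0, t, 1 - t] ∈ Aideal := by
  simp [Aideal, h0, h1]

/-- A point `(0, t, 1 - t)` lies in a translate `f + Q₀` with `f ∈ A` only if it equals `f`. -/
theorem eq_of_segment_eq_add {t : ℚ} {f q : Fin 3 → ℚ} (hf : f ∈ Aideal) (hq : q ∈ Qzero)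
    (h : ![0, t, 1 - t] = f + q) : f = ![0, t, 1 - t] := by
  obtain ⟨f0, f1, f2, f3⟩ := hf
  obtain ⟨q0, q1, q2, q3⟩ := hq
  have e0 : 0 = f 0 + q 0 := congrFun h 0
  have e1 : t = f 1 + q 1 := congrFun h 1
  have e2 : 1 - t = f 2 + q 2 := congrFun h 2
  ext i
  fin_cases i
  · change f 0 = 0
    linarith
  · change f 1 = t
    linarith
  · change f 2 = 1 - t
    linarith

/-- `A` is an ideal of the monoid `Q₀` which is not finitely generated: it is not a finite
union of translates `f + Q₀` with `f ∈ A`. -/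
theorem example_ideal_not_finitely_generated :
    Aideal ⊆ Qzero ∧
      (∀ x ∈ Aideal, ∀ q ∈ Qzero, x + q ∈ Aideal) ∧
      ¬ ∃ F : Finset (Fin 3 → ℚ), (F : Set (Fin 3 → ℚ)) ⊆ Aideal ∧
          Aideal = ⋃ f ∈ F, {w | ∃ q ∈ Qzero, w = f + q} := by
  refine ⟨fun a ⟨h0, h1, h2, h3⟩ => ⟨h0, h1, h2, zero_le_one.trans h3⟩, ?_, ?_⟩
  · rintro x ⟨x0, x1, x2, x3⟩ q ⟨q0, q1, q2, q3⟩
    refine ⟨?_, ?_, ?_, ?_⟩ <;> simp only [Pi.add_apply] <;> linarith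
  · rintro ⟨F, hFA, hF⟩
    have hsub : (fun t : ℚ => ![0, t, 1 - t]) '' Set.Icc 0 1 ⊆ (F : Set (Fin 3 → ℚ)) := by
      rintro _ ⟨t, ⟨h0, h1⟩, rfl⟩
      have hmem := segment_mem_Aideal h0 h1
      rw [hF] at hmem
      simp only [Set.mem_iUnion] at hmem
      obtain ⟨f, hf, q, hq, h⟩ := hmem
      change ![0, t, 1 - t] ∈ F
      rwa [← eq_of_segment_eq_add (hFA hf) hq h]
    have hinj : Function.Injective (fun t : ℚ => ![0, t, 1 - t]) := fun s t h => congrFun h 1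
    exact (Set.Icc_infinite (zero_lt_one' ℚ)).image hinj.injOn (F.finite_toSet.subset hsub)
end
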